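/- arXiv:0907.0845 — 4 statements merged into one kernel-verified Lean document; each statement's English description precedes it below -/
import Mathlib

section
/- Let G = (V,E) be an oriented graph and let k be a positive integer. Then (−1)^{ξ(G)} · φ̄_G(−k) equals the number of pairs (f,σ) where f is a Z_k-flow on G (not necessarily nowhere-zero) and σ ⊆ E \ supp(f) is a set of edges such that σ is a totally cyclic reorientation of the contraction G_/supp(f). -/
namespace ModularFlows

attribute [local instance] Classical.propDecidable

variable {V E : Type}

/-- A directed (simple) cycle, given by its cyclically ordered edges
`c 0, c 1, …, c n`: consecutive edges are head-to-tail compatible (also from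
`c n` back to `c 0`) and the start vertices are pairwise distinct. -/
def IsDirCycle (src tgt : E → V) (n : ℕ) (c : Fin (n + 1) → E) : Prop :=
  Function.Injective (fun i => src (c i)) ∧ ∀ i, tgt (c i) = src (c (i + 1))

/-- An oriented graph is totally cyclic if every edge lies on a directed cycle. -/
def TotallyCyclic (src tgt : E → V) : Prop :=
  ∀ e : E, ∃ (n : ℕ) (c : Fin (n + 1) → E), IsDirCycle src tgt n c ∧ e ∈ Set.range c

/-- An oriented graph is acyclic if it contains no directed cycle. -/
def Acyclic (src tgt : E → V) : Prop :=
  ∀ (n : ℕ) (c : Fin (n + 1) → E), ¬ IsDirCycle src tgt n c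

/-- Source map of the reorientation of the graph along `σ`. -/
noncomputable def rsrc (src tgt : E → V) (σ : Set E) (e : E) : V :=
  if e ∈ σ then tgt e else src e

/-- Target map of the reorientation of the graph along `σ`. -/
noncomputable def rtgt (src tgt : E → V) (σ : Set E) (e : E) : V :=
  if e ∈ σ then src e else tgt e

/-- A `ZMod k`-flow: conservation of flow at every vertex. -/
def IsFlow [Fintype E] (src tgt : E → V) (k : ℕ) (f : E → ZMod k) : Prop :=
  ∀ v : V, (∑ e : E, if tgt e = v then f e else 0) = ∑ e : E, if src e = v then f e else 0

/-- Start vertex of an edge traversed forwards (`true`) or backwards (`false`). -/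
def uSrc (src tgt : E → V) (p : E × Bool) : V := if p.2 then src p.1 else tgt p.1

/-- End vertex of an edge traversed forwards (`true`) or backwards (`false`). -/
def uTgt (src tgt : E → V) (p : E × Bool) : V := if p.2 then tgt p.1 else src p.1

/-- A cycle of the underlying undirected graph, with a chosen traversal
direction: a cyclic sequence of edges, each traversed forwards or backwards,
consecutive ones compatible, visiting pairwise distinct vertices. -/
def IsUCycle (src tgt : E → V) (n : ℕ) (c : Fin (n + 1) → E × Bool) : Prop :=
  Function.Injective (fun i => uSrc src tgt (c i)) ∧
    ∀ i, uTgt src tgt (c i) = uSrc src tgt (c (i + 1))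

/-- A `ZMod l`-tension: the signed sum over every cycle of the underlying
undirected graph (forward edges positively, backward edges negatively) vanishes. -/
def IsTension (src tgt : E → V) (l : ℕ) (t : E → ZMod l) : Prop :=
  ∀ (n : ℕ) (c : Fin (n + 1) → E × Bool), IsUCycle src tgt n c →
    (∑ i : Fin (n + 1), if (c i).2 then t (c i).1 else - t (c i).1) = 0

/-- Adjacency via an edge of `S` (its equivalence closure gives the components
of the spanning subgraph `(V, S)`). -/
def linkRel (src tgt : E → V) (S : Set E) (u v : V) : Prop :=
  ∃ e ∈ S, src e = u ∧ tgt e = v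

/-- Number of (weakly) connected components of the spanning subgraph `(V, S)`. -/
noncomputable def ncompSub (src tgt : E → V) (S : Set E) : ℕ :=
  Nat.card (Quot (linkRel src tgt S))

/-- Number of (weakly) connected components. -/
noncomputable def ncomp (src tgt : E → V) : ℕ :=
  ncompSub src tgt Set.univ

/-- The cyclotomic number `ξ(G) = |E| - |V| + c(G)`. -/
noncomputable def xi [Fintype V] [Fintype E] (src tgt : E → V) : ℤ :=
  (Fintype.card E : ℤ) - (Fintype.card V : ℤ) + (ncomp src tgt : ℤ)

/-- Source map of the contraction `G/S`: vertices are identified along edges of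
`S`, and the edges of `S` are removed. -/
def csrc (src tgt : E → V) (S : Set E) (e : {e : E // e ∉ S}) :
    Quot (linkRel src tgt S) :=
  Quot.mk _ (src e.1)

/-- Target map of the contraction `G/S`. -/
def ctgt (src tgt : E → V) (S : Set E) (e : {e : E // e ∉ S}) :
    Quot (linkRel src tgt S) :=
  Quot.mk _ (tgt e.1)

/-- Source (or target) map of the deletion `G∖S`. -/
def dsrc (src : E → V) (S : Set E) (e : {e : E // e ∉ S}) : V := src e.1

/-- Source (or target) map of the restriction `G[S]`. -/
def ressrc (src : E → V) (S : Set E) (e : {e : E // e ∈ S}) : V := src e.1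

/-- `σ` is a totally cyclic reorientation of the contraction `G/S`. -/
def TCReorContr (src tgt : E → V) (S σ : Set E) : Prop :=
  TotallyCyclic (rsrc (csrc src tgt S) (ctgt src tgt S) {e | e.1 ∈ σ})
                (rtgt (csrc src tgt S) (ctgt src tgt S) {e | e.1 ∈ σ})

/-- `σ` is a totally cyclic reorientation of the deletion `G∖S`. -/
def TCReorDel (src tgt : E → V) (S σ : Set E) : Prop :=
  TotallyCyclic (rsrc (dsrc src S) (dsrc tgt S) {e | e.1 ∈ σ})
                (rtgt (dsrc src S) (dsrc tgt S) {e | e.1 ∈ σ})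

/-- `σ` is an acyclic reorientation of the deletion `G∖S`. -/
def AcyclicReorDel (src tgt : E → V) (S σ : Set E) : Prop :=
  Acyclic (rsrc (dsrc src S) (dsrc tgt S) {e | e.1 ∈ σ})
          (rtgt (dsrc src S) (dsrc tgt S) {e | e.1 ∈ σ})

/-- Entry of the incidence matrix `A_G` at vertex `v` and edge `e`. -/
noncomputable def inc (src tgt : E → V) (v : V) (e : E) : ℤ :=
  (if tgt e = v then 1 else 0) - (if src e = v then 1 else 0)

/-- The number of nowhere-zero `ZMod k`-flows. -/
noncomputable def nzFlowCount [Fintype E] (src tgt : E → V) (k : ℕ) : ℕ :=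
  Nat.card {f : E → ZMod k // IsFlow src tgt k f ∧ ∀ e, f e ≠ 0}

/-- The number of nowhere-zero `ZMod l`-tensions. -/
noncomputable def nzTensionCount (src tgt : E → V) (l : ℕ) : ℕ :=
  Nat.card {t : E → ZMod l // IsTension src tgt l t ∧ ∀ e, t e ≠ 0}

/-- The rank `r(S) = |V| - c(V,S)` of an edge set `S`. -/
noncomputable def rk [Fintype V] (src tgt : E → V) (S : Set E) : ℕ :=
  Fintype.card V - ncompSub src tgt S

/-- The Tutte polynomial `t_G(x,y) = Σ_{S ⊆ E} (x-1)^{r(E)-r(S)} (y-1)^{|S|-r(S)}`. -/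
noncomputable def tutte [Fintype V] [Fintype E] (src tgt : E → V) (x y : ℚ) : ℚ :=
  ∑ S : Finset E,
    (x - 1) ^ (rk src tgt Set.univ - rk src tgt ↑S) * (y - 1) ^ (S.card - rk src tgt ↑S)

/-- `e` is a coloop (bridge): deleting it increases the number of components. -/
def IsColoop (src tgt : E → V) (e : E) : Prop :=
  ncompSub src tgt ({e} : Set E)ᶜ = ncomp src tgt + 1

/-- The number of pairs `(f, σ)` of a `ZMod k`-flow `f` and a totally cyclic
reorientation `σ ⊆ E ∖ supp f` of the contraction `G/supp f`. -/
noncomputable def phiR [Fintype E] (src tgt : E → V) (k : ℕ) : ℕ :=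
  Nat.card {p : (E → ZMod k) × Set E //
    IsFlow src tgt k p.1 ∧ p.2 ⊆ {e | p.1 e = 0} ∧
    TCReorContr src tgt {e | p.1 e ≠ 0} p.2}

/-- The in-degree sequence of the reorientation of the graph along `σ`. -/
noncomputable def indegSeq [Fintype E] (src tgt : E → V) (σ : Set E) (v : V) : ℤ :=
  (Nat.card {e : E // rtgt src tgt σ e = v} : ℤ)

/-- The vector `A_G · e_σ`, where `e_σ` is the characteristic vector of `σ`. -/
noncomputable def AeVec [Fintype E] (src tgt : E → V) (σ : Set E) (v : V) : ℤ :=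
  ∑ e : E, if e ∈ σ then inc src tgt v e else 0

/-- `τ'` is obtained from `τ` by reversing a directed cycle of `_τG`. -/
def cycleReverse (src tgt : E → V) (τ τ' : Set E) : Prop :=
  ∃ (n : ℕ) (c : Fin (n + 1) → E),
    IsDirCycle (rsrc src tgt τ) (rtgt src tgt τ) n c ∧ τ' = symmDiff τ (Set.range c)


section Relations

variable {α : Type} {r : α → α → Prop} {u v : α}

open Relation

/-- The relation `r` together with one additional arc from `u` to `v`. -/
def addArc (r : α → α → Prop) (u v a b : α) : Prop := r a b ∨ (a = u ∧ b = v)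

/-- Every arc of `r` lies on a closed directed walk of `r`. -/
def ArcsReturn (r : α → α → Prop) : Prop := ∀ a b, r a b → ReflTransGen r b a

lemma addArc_comm (r : α → α → Prop) (u v x y : α) :
    addArc (addArc r u v) x y = addArc (addArc r x y) u v := by
  ext a b
  simp only [addArc]
  tauto

lemma reflTransGen_addArc_mono (r : α → α → Prop) (u v : α) {a b : α} (h : ReflTransGen r a b) :
    ReflTransGen (addArc r u v) a b :=
  ReflTransGen.mono (fun _ _ => Or.inl) _ _ h

lemma reflTransGen_of_emulates {s t : α → α → Prop}
    (h : ∀ a b, s a b → ReflTransGen t a b) {a b : α} (hab : ReflTransGen s a b) :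
    ReflTransGen t a b := by
  induction hab with
  | refl => exact .refl
  | tail _ hbc ih => exact ih.trans (h _ _ hbc)

lemma reflTransGen_addArc {a b : α} (h : ReflTransGen (addArc r u v) a b) :
    ReflTransGen r a b ∨ (ReflTransGen r a u ∧ ReflTransGen r v b) := by
  induction h with
  | refl => exact Or.inl .refl
  | tail _ hbc ih =>
    rcases hbc with hbc | ⟨rfl, rfl⟩
    · rcases ih with ih | ⟨h1, h2⟩
      · exact Or.inl (ih.tail hbc)
      · exact Or.inr ⟨h1, h2.tail hbc⟩
    · rcases ih with ih | ⟨h1, h2⟩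
      · exact Or.inr ⟨ih, .refl⟩
      · exact Or.inr ⟨h1, .refl⟩

lemma reflTransGen_addArc_addArc {a b : α}
    (h : ReflTransGen (addArc (addArc r u v) v u) a b) :
    ReflTransGen r a b ∨ (ReflTransGen r a u ∧ ReflTransGen r v b) ∨
      (ReflTransGen r a v ∧ ReflTransGen r u b) := by
  induction h with
  | refl => exact Or.inl .refl
  | tail _ hbc ih =>
    rcases hbc with (hbc | ⟨rfl, rfl⟩) | ⟨rfl, rfl⟩
    · rcases ih with ih | ⟨h1, h2⟩ | ⟨h1, h2⟩
      · exact Or.inl (ih.tail hbc)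
      · exact Or.inr (Or.inl ⟨h1, h2.tail hbc⟩)
      · exact Or.inr (Or.inr ⟨h1, h2.tail hbc⟩)
    · rcases ih with ih | ⟨h1, h2⟩ | ⟨h1, h2⟩
      · exact Or.inr (Or.inl ⟨ih, .refl⟩)
      · exact Or.inr (Or.inl ⟨h1, .refl⟩)
      · exact Or.inl h1
    · rcases ih with ih | ⟨h1, h2⟩ | ⟨h1, h2⟩
      · exact Or.inr (Or.inr ⟨ih, .refl⟩)
      · exact Or.inl h1
      · exact Or.inr (Or.inr ⟨h1, .refl⟩)

lemma ArcsReturn.reflTransGen_of_eqvGen (h : ArcsReturn r) {a b : α} (hab : EqvGen r a b) :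
    ReflTransGen r a b ∧ ReflTransGen r b a := by
  induction hab with
  | rel a b hr => exact ⟨.single hr, h _ _ hr⟩
  | refl a => exact ⟨.refl, .refl⟩
  | symm a b _ ih => exact ih.symm
  | trans a b c _ _ ih1 ih2 => exact ⟨ih1.1.trans ih2.1, ih2.2.trans ih1.2⟩

lemma ArcsReturn.reflTransGen_of_addArc (h : ArcsReturn (addArc r u v)) :
    ReflTransGen r v u := by
  rcases reflTransGen_addArc (h u v (Or.inr ⟨rfl, rfl⟩)) with h | h
  exacts [h, h.1]

lemma ArcsReturn.addArc_flip (h : ArcsReturn (addArc r u v)) :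
    ArcsReturn (addArc (addArc r u v) v u) := by
  rintro a b (hab | ⟨rfl, rfl⟩)
  · exact reflTransGen_addArc_mono _ _ _ (h _ _ hab)
  · exact .single (Or.inl (Or.inr ⟨rfl, rfl⟩))

lemma ArcsReturn.reach_or_reach (h : ArcsReturn (addArc (addArc r u v) v u))
    (huv : EqvGen r u v) : ReflTransGen r u v ∨ ReflTransGen r v u := by
  by_contra! hcon
  have key : ∀ a b, EqvGen r a b → (ReflTransGen r u a ↔ ReflTransGen r u b) := by
    intro a b hab
    induction hab with
    | rel a b hr =>
      refine ⟨fun ha => ha.tail hr, fun hb => ?_⟩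
      rcases reflTransGen_addArc_addArc (h a b (Or.inl (Or.inl hr))) with h1 | ⟨h1, h2⟩ | h1
      · exact hb.trans h1
      · exact absurd ((h2.tail hr).trans h1) hcon.2
      · exact h1.2
    | refl a => rfl
    | symm a b _ ih => exact ih.symm
    | trans a b c _ _ ih1 ih2 => exact ih1.trans ih2
  exact hcon.1 ((key u v huv).1 .refl)

lemma ArcsReturn.addArc_of_reach (h : ArcsReturn (addArc (addArc r u v) v u))
    (hvu : ReflTransGen r v u) : ArcsReturn (addArc r u v) := by
  intro a b hab
  refine reflTransGen_of_emulates ?_ (h a b (Or.inl hab))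
  rintro x y (hxy | ⟨rfl, rfl⟩)
  · exact .single hxy
  · exact reflTransGen_addArc_mono _ _ _ hvu

lemma ArcsReturn.addArc_of_eqvGen (h : ArcsReturn r) (huv : EqvGen r u v) :
    ArcsReturn (addArc r u v) := by
  rintro a b (hab | ⟨rfl, rfl⟩)
  · exact reflTransGen_addArc_mono _ _ _ (h _ _ hab)
  · exact reflTransGen_addArc_mono _ _ _ (h.reflTransGen_of_eqvGen huv).2

lemma arcsReturn_or_iff (huv : EqvGen r u v) :
    ArcsReturn (addArc r u v) ∨ ArcsReturn (addArc r v u) ↔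
      ArcsReturn (addArc (addArc r u v) v u) := by
  constructor
  · rintro (h | h)
    · exact h.addArc_flip
    · rw [addArc_comm]
      exact h.addArc_flip
  · intro h
    rcases h.reach_or_reach huv with h1 | h1
    · rw [addArc_comm] at h
      exact Or.inr (h.addArc_of_reach h1)
    · exact Or.inl (h.addArc_of_reach h1)

lemma arcsReturn_and_iff (huv : EqvGen r u v) :
    ArcsReturn (addArc r u v) ∧ ArcsReturn (addArc r v u) ↔ ArcsReturn r := by
  constructor
  · rintro ⟨h1, h2⟩ a b hab
    rcases reflTransGen_addArc (h1 a b (Or.inl hab)) with h | ⟨h3, h4⟩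
    · exact h
    · exact (h3.trans h2.reflTransGen_of_addArc).trans h4
  · intro h
    exact ⟨h.addArc_of_eqvGen huv, h.addArc_of_eqvGen (huv.symm _ _)⟩

lemma not_arcsReturn_addArc (huv : ¬ EqvGen r u v) : ¬ ArcsReturn (addArc r u v) :=
  fun h => huv ((EqvGen.reflTransGen_le_eqvGen _ _ _ h.reflTransGen_of_addArc).symm _ _)

lemma arcsReturn_addArc_addArc_iff (huv : ¬ EqvGen r u v) :
    ArcsReturn (addArc (addArc r u v) v u) ↔ ArcsReturn r := by
  constructor
  · intro h a b hab
    rcases reflTransGen_addArc_addArc (h a b (Or.inl (Or.inl hab))) with h1 | ⟨h1, h2⟩ | ⟨h1, h2⟩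
    · exact h1
    · exact absurd ((EqvGen.reflTransGen_le_eqvGen _ _ _ ((h2.tail hab).trans h1)).symm _ _) huv
    · exact absurd (EqvGen.reflTransGen_le_eqvGen _ _ _ ((h2.tail hab).trans h1)) huv
  · rintro h a b ((hab | ⟨rfl, rfl⟩) | ⟨rfl, rfl⟩)
    · exact reflTransGen_addArc_mono _ _ _ (reflTransGen_addArc_mono _ _ _ (h _ _ hab))
    · exact .single (Or.inr ⟨rfl, rfl⟩)
    · exact .single (Or.inl (Or.inr ⟨rfl, rfl⟩))

end Relations

section TotallyCyclic

open Relation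

/-- There is an edge from `a` to `b`. -/
def edgeRel (src tgt : E → V) (a b : V) : Prop := ∃ e, src e = a ∧ tgt e = b

lemma IsDirCycle.reflTransGen {src tgt : E → V} {n : ℕ} {c : Fin (n + 1) → E}
    (hc : IsDirCycle src tgt n c) (i : Fin (n + 1)) :
    ReflTransGen (edgeRel src tgt) (tgt (c i)) (src (c i)) := by
  have hsucc : ∀ m : ℕ, Fin.ofNat (n + 1) m + 1 = Fin.ofNat (n + 1) (m + 1) := by
    intro m
    ext
    simp [Fin.val_add]
  have key : ∀ j : ℕ, ReflTransGen (edgeRel src tgt) (tgt (c i))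
      (src (c (Fin.ofNat (n + 1) (i + 1 + j)))) := by
    intro j
    induction j with
    | zero =>
      rw [add_zero, ← hsucc, hc.2]
      simpa using ReflTransGen.refl
    | succ j ih => exact ih.tail ⟨_, rfl, by rw [hc.2, hsucc, add_assoc]⟩
  have hn : Fin.ofNat (n + 1) (i + 1 + n) = i := by
    ext
    rw [add_assoc, add_comm 1 n]
    simpa using Fin.is_le i
  simpa only [hn] using key n

lemma exists_seq_of_reflTransGen {α : Type} {r : α → α → Prop} {a b : α}
    (h : ReflTransGen r a b) :
    ∃ (d : ℕ) (p : ℕ → α), p 0 = a ∧ p d = b ∧ ∀ i < d, r (p i) (p (i + 1)) := by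
  induction h using ReflTransGen.head_induction_on with
  | refl => exact ⟨0, fun _ => b, rfl, rfl, by simp⟩
  | head hac _ ih =>
    rename_i x _ _
    obtain ⟨d, p, h0, hd, hp⟩ := ih
    refine ⟨d + 1, fun i => if i = 0 then x else p (i - 1), by simp, by simpa using hd, ?_⟩
    rintro (_ | i) hi
    · simpa [h0] using hac
    · simpa using hp i (by omega)

lemma exists_injOn_seq_of_reflTransGen {α : Type} {r : α → α → Prop} {a b : α}
    (h : ReflTransGen r a b) :
    ∃ (d : ℕ) (p : ℕ → α), p 0 = a ∧ p d = b ∧ (∀ i < d, r (p i) (p (i + 1))) ∧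
      ∀ i j, i < j → j ≤ d → p i ≠ p j := by
  have hex := exists_seq_of_reflTransGen h
  obtain ⟨p, h0, hd, hp⟩ := Nat.find_spec hex
  refine ⟨Nat.find hex, p, h0, hd, hp, fun i j hij hjd heq => ?_⟩
  refine Nat.find_min hex (m := Nat.find hex - (j - i)) (by omega)
    ⟨fun k => if k ≤ i then p k else p (k + (j - i)), by simp [h0], ?_, ?_⟩
  · dsimp only
    split_ifs with hle
    · have h1 : Nat.find hex = j := by omega
      have h2 : Nat.find hex - (j - i) = i := by omega
      rw [h2, heq, ← h1, hd]
    · rw [Nat.sub_add_cancel (by omega), hd]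
  · intro k hk
    dsimp only
    rcases lt_trichotomy k i with hki | rfl | hki
    · rw [if_pos hki.le, if_pos (by omega)]
      exact hp k (by omega)
    · rw [if_pos le_rfl, if_neg (by omega), heq]
      have : k + 1 + (j - k) = j + 1 := by omega
      rw [this]
      exact hp j (by omega)
    · rw [if_neg (by omega), if_neg (by omega)]
      have : k + 1 + (j - i) = k + (j - i) + 1 := by omega
      rw [this]
      exact hp _ (by omega)

lemma exists_isDirCycle {src tgt : E → V} {e : E}
    (h : ReflTransGen (edgeRel src tgt) (tgt e) (src e)) :
    ∃ (n : ℕ) (c : Fin (n + 1) → E), IsDirCycle src tgt n c ∧ e ∈ Set.range c := by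
  obtain ⟨d, p, h0, hd, hp, hinj⟩ := exists_injOn_seq_of_reflTransGen h
  have : Nonempty E := ⟨e⟩
  choose! q hqs hqt using hp
  have hsrc : ∀ i : Fin (d + 1), src (if (i : ℕ) < d then q i else e) = p i := by
    intro i
    split_ifs with hi
    · exact hqs i hi
    · rw [← hd]
      congr 1
      omega
  refine ⟨d, fun i => if (i : ℕ) < d then q i else e, ⟨?_, ?_⟩, Fin.last d, by simp⟩
  · intro i j hij
    simp only [hsrc] at hij
    rcases lt_trichotomy i j with hlt | heq | hlt
    · exact absurd hij (hinj i j hlt (by omega))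
    · exact heq
    · exact absurd hij.symm (hinj j i hlt (by omega))
  · intro i
    rw [hsrc, Fin.val_add_one]
    by_cases hi : i = Fin.last d
    · simp [hi, h0]
    · have hlt : (i : ℕ) < d := Fin.val_lt_last hi
      simp only [if_pos hlt, if_neg hi]
      exact hqt i hlt

lemma totallyCyclic_iff (src tgt : E → V) :
    TotallyCyclic src tgt ↔ ∀ e, ReflTransGen (edgeRel src tgt) (tgt e) (src e) := by
  constructor
  · intro h e
    obtain ⟨n, c, hc, i, rfl⟩ := h e
    exact hc.reflTransGen i
  · exact fun h e => exists_isDirCycle (h e)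

/-- The arcs of the orientation of `A` along `σ`, together with the edges of `C`
usable in both directions. -/
def mixedRel (src tgt : E → V) (A C : Set E) (σ : Set E) (a b : V) : Prop :=
  (∃ e ∈ A, rsrc src tgt σ e = a ∧ rtgt src tgt σ e = b) ∨
    ∃ e ∈ C, (src e = a ∧ tgt e = b) ∨ (tgt e = a ∧ src e = b)

lemma reflTransGen_of_quot_eq {src tgt : E → V} {A C σ : Set E} {a b : V}
    (h : Quot.mk (linkRel src tgt C) a = Quot.mk _ b) :
    ReflTransGen (mixedRel src tgt A C σ) a b := by
  replace h := Quot.eqvGen_exact h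
  suffices ReflTransGen (mixedRel src tgt A C σ) a b ∧
      ReflTransGen (mixedRel src tgt A C σ) b a from this.1
  induction h with
  | rel a b hr =>
    obtain ⟨e, he, rfl, rfl⟩ := hr
    exact ⟨.single (Or.inr ⟨e, he, Or.inl ⟨rfl, rfl⟩⟩),
      .single (Or.inr ⟨e, he, Or.inr ⟨rfl, rfl⟩⟩)⟩
  | refl a => exact ⟨.refl, .refl⟩
  | symm a b _ ih => exact ih.symm
  | trans a b c _ _ ih1 ih2 => exact ⟨ih1.1.trans ih2.1, ih2.2.trans ih1.2⟩

lemma rsrc_contr (src tgt : E → V) (S σ : Set E) (e : {e : E // e ∉ S}) :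
    rsrc (csrc src tgt S) (ctgt src tgt S) {e | e.1 ∈ σ} e =
      Quot.mk _ (rsrc src tgt σ e.1) := by
  simp only [rsrc, csrc, ctgt, Set.mem_ofPred_eq]
  split_ifs <;> rfl

lemma rtgt_contr (src tgt : E → V) (S σ : Set E) (e : {e : E // e ∉ S}) :
    rtgt (csrc src tgt S) (ctgt src tgt S) {e | e.1 ∈ σ} e =
      Quot.mk _ (rtgt src tgt σ e.1) := by
  simp only [rtgt, csrc, ctgt, Set.mem_ofPred_eq]
  split_ifs <;> rfl

lemma reflTransGen_contr_iff (src tgt : E → V) (S σ : Set E) (a b : V) :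
    ReflTransGen (edgeRel (rsrc (csrc src tgt S) (ctgt src tgt S) {e | e.1 ∈ σ})
      (rtgt (csrc src tgt S) (ctgt src tgt S) {e | e.1 ∈ σ})) (Quot.mk _ a) (Quot.mk _ b) ↔
      ReflTransGen (mixedRel src tgt Sᶜ S σ) a b := by
  constructor
  · suffices ∀ y, ReflTransGen (edgeRel (rsrc (csrc src tgt S) (ctgt src tgt S) {e | e.1 ∈ σ})
      (rtgt (csrc src tgt S) (ctgt src tgt S) {e | e.1 ∈ σ})) (Quot.mk _ a) y →
      ∀ b, Quot.mk _ b = y → ReflTransGen (mixedRel src tgt Sᶜ S σ) a b from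
      fun h => this _ h b rfl
    intro y h
    induction h with
    | refl => exact fun b hb => reflTransGen_of_quot_eq hb.symm
    | tail _ hbc ih =>
      intro b hb
      obtain ⟨e, h1, h2⟩ := hbc
      rw [rsrc_contr] at h1
      rw [rtgt_contr] at h2
      exact ((ih _ h1).tail (Or.inl ⟨e.1, e.2, rfl, rfl⟩)).trans
        (reflTransGen_of_quot_eq (h2.trans hb.symm))
  · intro h
    induction h with
    | refl => exact .refl
    | tail _ hbc ih =>
      rcases hbc with ⟨e, he, rfl, rfl⟩ | ⟨e, he, ⟨rfl, rfl⟩ | ⟨rfl, rfl⟩⟩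
      · exact ih.tail ⟨⟨e, he⟩, rsrc_contr .., rtgt_contr ..⟩
      · have : Quot.mk (linkRel src tgt S) (src e) = Quot.mk _ (tgt e) :=
          Quot.sound ⟨e, he, rfl, rfl⟩
        rwa [← this]
      · have : Quot.mk (linkRel src tgt S) (src e) = Quot.mk _ (tgt e) :=
          Quot.sound ⟨e, he, rfl, rfl⟩
        rwa [this]

lemma tcReorContr_iff (src tgt : E → V) (S σ : Set E) :
    TCReorContr src tgt S σ ↔ ArcsReturn (mixedRel src tgt Sᶜ S σ) := by
  rw [TCReorContr, totallyCyclic_iff]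
  simp only [rsrc_contr, rtgt_contr, reflTransGen_contr_iff]
  constructor
  · rintro h a b (⟨e, he, rfl, rfl⟩ | ⟨e, he, h1⟩)
    · exact h ⟨e, he⟩
    · exact .single (Or.inr ⟨e, he, h1.symm.imp And.symm And.symm⟩)
  · exact fun h e => h _ _ (Or.inl ⟨e.1, e.2, rfl, rfl⟩)

end TotallyCyclic

section Counting

open Relation

lemma linkRel_insert (src tgt : E → V) (S : Set E) (e : E) :
    linkRel src tgt (insert e S) = addArc (linkRel src tgt S) (src e) (tgt e) := by
  ext a b
  constructor
  · rintro ⟨f, rfl | hf, rfl, rfl⟩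
    exacts [Or.inr ⟨rfl, rfl⟩, Or.inl ⟨f, hf, rfl, rfl⟩]
  · rintro (⟨f, hf, rfl, rfl⟩ | ⟨rfl, rfl⟩)
    exacts [⟨f, Or.inr hf, rfl, rfl⟩, ⟨e, Or.inl rfl, rfl, rfl⟩]

lemma eqvGen_addArc {α : Type} {r : α → α → Prop} {u v a b : α}
    (h : EqvGen (addArc r u v) a b) :
    EqvGen r a b ∨ (EqvGen r a u ∧ EqvGen r v b) ∨ (EqvGen r a v ∧ EqvGen r u b) := by
  induction h with
  | rel a b hr =>
    rcases hr with hr | ⟨rfl, rfl⟩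
    exacts [Or.inl (.rel _ _ hr), Or.inr (Or.inl ⟨.refl _, .refl _⟩)]
  | refl a => exact Or.inl (.refl _)
  | symm a b _ ih =>
    rcases ih with h | ⟨h1, h2⟩ | ⟨h1, h2⟩
    · exact Or.inl (h.symm _ _)
    · exact Or.inr (Or.inr ⟨h2.symm _ _, h1.symm _ _⟩)
    · exact Or.inr (Or.inl ⟨h2.symm _ _, h1.symm _ _⟩)
  | trans a b c _ _ ih1 ih2 =>
    rcases ih1 with h | ⟨h1, h2⟩ | ⟨h1, h2⟩ <;> rcases ih2 with h' | ⟨h1', h2'⟩ | ⟨h1', h2'⟩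
    · exact Or.inl (h.trans _ _ _ h')
    · exact Or.inr (Or.inl ⟨h.trans _ _ _ h1', h2'⟩)
    · exact Or.inr (Or.inr ⟨h.trans _ _ _ h1', h2'⟩)
    · exact Or.inr (Or.inl ⟨h1, h2.trans _ _ _ h'⟩)
    · exact Or.inr (Or.inl ⟨h1, h2'⟩)
    · exact Or.inl (h1.trans _ _ _ h2')
    · exact Or.inr (Or.inr ⟨h1, h2.trans _ _ _ h'⟩)
    · exact Or.inl (h1.trans _ _ _ h2')
    · exact Or.inr (Or.inr ⟨h1, h2'⟩)

lemma eqvGen_le_eqvGen {α : Type} {r s : α → α → Prop}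
    (h : ∀ a b, r a b → EqvGen s a b) {a b : α} (hab : EqvGen r a b) : EqvGen s a b := by
  induction hab with
  | rel a b hr => exact h a b hr
  | refl a => exact .refl a
  | symm a b _ ih => exact ih.symm
  | trans a b c _ _ ih1 ih2 => exact ih1.trans _ _ _ ih2

lemma eqvGen_mixedRel_iff (src tgt : E → V) (A C σ : Set E) (a b : V) :
    EqvGen (mixedRel src tgt A C σ) a b ↔ EqvGen (linkRel src tgt (A ∪ C)) a b := by
  constructor
  · refine eqvGen_le_eqvGen ?_
    rintro a b (⟨e, he, rfl, rfl⟩ | ⟨e, he, ⟨rfl, rfl⟩ | ⟨rfl, rfl⟩⟩)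
    · unfold rsrc rtgt
      split_ifs
      · exact .symm _ _ (.rel _ _ ⟨e, Or.inl he, rfl, rfl⟩)
      · exact .rel _ _ ⟨e, Or.inl he, rfl, rfl⟩
    · exact .rel _ _ ⟨e, Or.inr he, rfl, rfl⟩
    · exact .symm _ _ (.rel _ _ ⟨e, Or.inr he, rfl, rfl⟩)
  · refine eqvGen_le_eqvGen ?_
    rintro a b ⟨e, he | he, rfl, rfl⟩
    · by_cases hσ : e ∈ σ
      · exact .symm _ _ (.rel _ _ (Or.inl ⟨e, he, by simp [rsrc, hσ], by simp [rtgt, hσ]⟩))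
      · exact .rel _ _ (Or.inl ⟨e, he, by simp [rsrc, hσ], by simp [rtgt, hσ]⟩)
    · exact .rel _ _ (Or.inr ⟨e, he, Or.inl ⟨rfl, rfl⟩⟩)

lemma ncompSub_insert_of_eqvGen {src tgt : E → V} {S : Set E} {e : E}
    (h : EqvGen (linkRel src tgt S) (src e) (tgt e)) :
    ncompSub src tgt (insert e S) = ncompSub src tgt S := by
  let q : Quot (linkRel src tgt S) → Quot (linkRel src tgt (insert e S)) :=
    Quot.map id fun a b ⟨f, hf, h⟩ => ⟨f, Or.inr hf, h⟩
  refine (Nat.card_congr (Equiv.ofBijective q ⟨?_, ?_⟩)).symm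
  · rintro ⟨a⟩ ⟨b⟩ hab
    have hab := Quot.eqvGen_exact hab
    rw [linkRel_insert] at hab
    refine Quot.eqvGen_sound (eqvGen_le_eqvGen ?_ hab)
    rintro x y (hxy | ⟨rfl, rfl⟩)
    exacts [.rel _ _ hxy, h]
  · rintro ⟨a⟩
    exact ⟨Quot.mk _ a, rfl⟩

lemma ncompSub_insert_of_not_eqvGen [Finite V] {src tgt : E → V} {S : Set E} {e : E}
    (h : ¬ EqvGen (linkRel src tgt S) (src e) (tgt e)) :
    ncompSub src tgt (insert e S) + 1 = ncompSub src tgt S := by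
  let q : Quot (linkRel src tgt S) → Quot (linkRel src tgt (insert e S)) :=
    Quot.map id fun a b ⟨f, hf, h⟩ => ⟨f, Or.inr hf, h⟩
  let x₀ : Quot (linkRel src tgt S) := Quot.mk _ (src e)
  have hbij : Function.Bijective fun x : {x // x ≠ x₀} => q x.1 := by
    constructor
    · rintro ⟨⟨a⟩, ha⟩ ⟨⟨b⟩, hb⟩ hab
      have hab := Quot.eqvGen_exact hab
      rw [linkRel_insert] at hab
      refine Subtype.ext (Quot.eqvGen_sound ?_)
      rcases eqvGen_addArc hab with h1 | ⟨h1, -⟩ | ⟨-, h1⟩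
      · exact h1
      · exact absurd (Quot.eqvGen_sound h1) ha
      · exact absurd (Quot.eqvGen_sound (h1.symm _ _)) hb
    · rintro ⟨a⟩
      by_cases ha : EqvGen (linkRel src tgt S) a (src e)
      · refine ⟨⟨Quot.mk _ (tgt e), fun hx => h ((Quot.eqvGen_exact hx).symm _ _)⟩, ?_⟩
        refine Quot.eqvGen_sound (.symm _ _ ?_)
        rw [linkRel_insert]
        exact .trans _ _ _ (EqvGen.mono (fun _ _ => Or.inl) _ _ ha)
          (.rel _ _ (Or.inr ⟨rfl, rfl⟩))
      · exact ⟨⟨Quot.mk _ a, fun hx => ha (Quot.eqvGen_exact hx)⟩, rfl⟩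
  have : Finite (Quot (linkRel src tgt S)) := Quot.finite _
  have : Fintype (Quot (linkRel src tgt S)) := Fintype.ofFinite _
  rw [ncompSub, ncompSub, ← Nat.card_congr (Equiv.ofBijective _ hbij), Nat.card_eq_fintype_card,
    Nat.card_eq_fintype_card, Fintype.card_subtype_compl, Fintype.card_subtype_eq]
  have : 0 < Fintype.card (Quot (linkRel src tgt S)) := Fintype.card_pos_iff.2 ⟨x₀⟩
  omega

lemma rsrc_congr (src tgt : E → V) {σ τ : Set E} {e : E} (h : e ∈ σ ↔ e ∈ τ) :
    rsrc src tgt σ e = rsrc src tgt τ e := by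
  simp only [rsrc, h]

lemma rtgt_congr (src tgt : E → V) {σ τ : Set E} {e : E} (h : e ∈ σ ↔ e ∈ τ) :
    rtgt src tgt σ e = rtgt src tgt τ e := by
  simp only [rtgt, h]

lemma mixedRel_insert_left (src tgt : E → V) (A C σ : Set E) (e : E) :
    mixedRel src tgt (insert e A) C σ =
      addArc (mixedRel src tgt A C σ) (rsrc src tgt σ e) (rtgt src tgt σ e) := by
  ext a b
  simp only [mixedRel, addArc, Set.mem_insert_iff, or_and_right, exists_or, exists_eq_left]
  rw [eq_comm (a := a), eq_comm (a := b), or_assoc, or_comm]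

lemma mixedRel_insert_right (src tgt : E → V) (A C σ : Set E) (e : E) :
    mixedRel src tgt A (insert e C) σ =
      addArc (addArc (mixedRel src tgt A C σ) (src e) (tgt e)) (tgt e) (src e) := by
  ext a b
  simp only [mixedRel, addArc, Set.mem_insert_iff, or_and_right, exists_or, exists_eq_left]
  rw [eq_comm (a := a), eq_comm (a := b), eq_comm (a := a), eq_comm (a := b)]
  simp only [or_assoc, or_comm]

lemma mixedRel_insert_orientation (src tgt : E → V) {A : Set E} (C σ : Set E) {e : E}
    (he : e ∉ A) :
    mixedRel src tgt A C (insert e σ) = mixedRel src tgt A C σ := by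
  have hmem : ∀ f ∈ A, (f ∈ insert e σ ↔ f ∈ σ) := by
    intro f hf
    rw [Set.mem_insert_iff, or_iff_right]
    rintro rfl
    exact he hf
  ext a b
  simp only [mixedRel]
  refine or_congr_left (exists_congr fun f => and_congr_right fun hf => ?_)
  rw [rsrc_congr src tgt (hmem f hf), rtgt_congr src tgt (hmem f hf)]

/-- The number of reorientations of `A` for which every edge of `A` lies on a closed walk
that may use the edges of `C` in both directions. -/
noncomputable def tcCount (src tgt : E → V) (A C : Finset E) : ℤ :=
  ∑ σ ∈ A.powerset, if ArcsReturn (mixedRel src tgt (A : Set E) C σ) then 1 else 0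

lemma tcCount_insert (src tgt : E → V) {A : Finset E} (C : Finset E) {e : E} (he : e ∉ A) :
    tcCount src tgt (insert e A) C =
      if EqvGen (linkRel src tgt (A ∪ C : Finset E)) (src e) (tgt e) then
        tcCount src tgt A (insert e C) + tcCount src tgt A C else 0 := by
  have hins : tcCount src tgt (insert e A) C = ∑ σ ∈ A.powerset,
      ((if ArcsReturn (addArc (mixedRel src tgt (A : Set E) C σ) (src e) (tgt e))
          then (1 : ℤ) else 0) +
        if ArcsReturn (addArc (mixedRel src tgt (A : Set E) C σ) (tgt e) (src e))
          then 1 else 0) := by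
    rw [tcCount, Finset.sum_powerset_insert he, Finset.sum_add_distrib]
    congr 1
    · refine Finset.sum_congr rfl fun σ hσ => ?_
      have heσ : e ∉ σ := fun h => he (Finset.mem_powerset.1 hσ h)
      rw [Finset.coe_insert, mixedRel_insert_left]
      simp [rsrc, rtgt, heσ]
    · refine Finset.sum_congr rfl fun σ hσ => ?_
      rw [Finset.coe_insert, Finset.coe_insert, mixedRel_insert_left,
        mixedRel_insert_orientation src tgt _ _ (by simpa using he)]
      simp [rsrc, rtgt]
  rw [hins]
  split_ifs with hconn
  · rw [tcCount, tcCount, ← Finset.sum_add_distrib]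
    refine Finset.sum_congr rfl fun σ hσ => ?_
    have huv : EqvGen (mixedRel src tgt (A : Set E) C σ) (src e) (tgt e) := by
      rw [eqvGen_mixedRel_iff, ← Finset.coe_union]
      exact hconn
    rw [Finset.coe_insert, mixedRel_insert_right]
    have h1 := arcsReturn_or_iff huv
    have h2 := arcsReturn_and_iff huv
    simp only [← h1, ← h2]
    split_ifs <;> first | rfl | tauto
  · refine Finset.sum_eq_zero fun σ hσ => ?_
    have huv : ¬ EqvGen (mixedRel src tgt (A : Set E) C σ) (src e) (tgt e) := by
      rw [eqvGen_mixedRel_iff, ← Finset.coe_union]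
      exact hconn
    rw [if_neg (not_arcsReturn_addArc huv),
      if_neg (not_arcsReturn_addArc fun h => huv (h.symm _ _)), add_zero]

lemma tcCount_insert_right (src tgt : E → V) (A C : Finset E) {e : E}
    (h : ¬ EqvGen (linkRel src tgt (A ∪ C : Finset E)) (src e) (tgt e)) :
    tcCount src tgt A (insert e C) = tcCount src tgt A C := by
  refine Finset.sum_congr rfl fun σ _ => ?_
  rw [Finset.coe_insert, mixedRel_insert_right, arcsReturn_addArc_addArc_iff]
  rwa [eqvGen_mixedRel_iff, ← Finset.coe_union]

/-- The alternating subset expansion of the number of totally cyclic reorientations. -/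
lemma tcCount_eq_sum [Finite V] (src tgt : E → V) (A C : Finset E) :
    tcCount src tgt A C = ∑ S ∈ A.powerset,
      (-1) ^ (ncompSub src tgt (S ∪ C : Finset E) + ncompSub src tgt (A ∪ C : Finset E)) := by
  induction A using Finset.induction_on generalizing C with
  | empty =>
    have : ArcsReturn (mixedRel src tgt ((∅ : Finset E) : Set E) C ((∅ : Finset E) : Set E)) := by
      rintro a b (⟨e, he, -⟩ | ⟨e, he, h⟩)
      · simp at he
      · exact .single (Or.inr ⟨e, he, h.symm.imp And.symm And.symm⟩)
    simp only [tcCount, Finset.powerset_empty, Finset.sum_singleton, if_pos this, ← two_mul,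
      pow_mul, neg_one_sq, one_pow]
  | insert e A he ih =>
    have hsum : (∑ S ∈ (insert e A).powerset, (-1 : ℤ) ^ (ncompSub src tgt (S ∪ C : Finset E) +
        ncompSub src tgt (insert e A ∪ C : Finset E))) =
        (-1) ^ (ncompSub src tgt (insert e (A ∪ C : Finset E) : Set E) +
          ncompSub src tgt (A ∪ C : Finset E)) * tcCount src tgt A C +
        tcCount src tgt A (insert e C) := by
      rw [ih, ih, Finset.sum_powerset_insert he, Finset.mul_sum, ← Finset.coe_insert]
      simp only [Finset.insert_union, Finset.union_insert]
      congr 1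
      refine Finset.sum_congr rfl fun S _ => ?_
      rw [← pow_add, neg_one_pow_congr]
      grind
    rw [hsum, tcCount_insert src tgt C he]
    split_ifs with h
    · rw [ncompSub_insert_of_eqvGen h, ← two_mul, pow_mul, neg_one_sq, one_pow, one_mul, add_comm]
    · rw [tcCount_insert_right src tgt A C h, ← ncompSub_insert_of_not_eqvGen h, ← add_assoc,
        ← two_mul, pow_succ, pow_mul, neg_one_sq, one_pow]
      ring

lemma ncompSub_empty [Fintype V] (src tgt : E → V) :
    ncompSub src tgt (∅ : Set E) = Fintype.card V := by
  rw [ncompSub, ← Nat.card_eq_fintype_card]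
  refine (Nat.card_congr
    (Equiv.ofBijective (Quot.mk _) ⟨fun a b hab => ?_, Quot.mk_surjective⟩)).symm
  have h := Quot.eqvGen_exact hab
  induction h with
  | rel a b hr =>
    obtain ⟨e, he, -⟩ := hr
    exact absurd he (Set.notMem_empty e)
  | refl => rfl
  | symm a b h ih => exact (ih (Quot.eqvGen_sound h)).symm
  | trans a b c h1 h2 ih1 ih2 =>
    exact (ih1 (Quot.eqvGen_sound h1)).trans (ih2 (Quot.eqvGen_sound h2))

/-- The cyclotomic number of the spanning subgraph `(V, S)`. -/
noncomputable def subXi [Fintype V] (src tgt : E → V) (S : Finset E) : ℕ :=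
  S.card + ncompSub src tgt S - Fintype.card V

lemma card_le_card_add_ncompSub [Fintype V] (src tgt : E → V) (S : Finset E) :
    Fintype.card V ≤ S.card + ncompSub src tgt S := by
  induction S using Finset.induction_on with
  | empty => simp [ncompSub_empty]
  | insert e S he ih =>
    rw [Finset.card_insert_of_notMem he, Finset.coe_insert]
    by_cases h : EqvGen (linkRel src tgt S) (src e) (tgt e)
    · rw [ncompSub_insert_of_eqvGen h]
      omega
    · have := ncompSub_insert_of_not_eqvGen h
      omega

end Counting

section Flows

open Relation

variable [Fintype E] {k : ℕ}

/-- The net inflow of `f` at every vertex. -/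
noncomputable def netFlow (src tgt : E → V) (k : ℕ) : (E → ZMod k) →ₗ[ZMod k] (V → ZMod k) where
  toFun f v := (∑ e, if tgt e = v then f e else 0) - ∑ e, if src e = v then f e else 0
  map_add' f g := by
    ext v
    simp only [Pi.add_apply, ← Finset.sum_sub_distrib, ← Finset.sum_add_distrib]
    refine Finset.sum_congr rfl fun e _ => ?_
    split_ifs <;> ring
  map_smul' x f := by
    ext v
    simp only [Pi.smul_apply, smul_eq_mul, RingHom.id_apply, mul_sub, Finset.mul_sum, mul_ite,
      mul_zero]

lemma isFlow_iff (src tgt : E → V) (f : E → ZMod k) :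
    IsFlow src tgt k f ↔ netFlow src tgt k f = 0 := by
  simp only [IsFlow, funext_iff, netFlow, LinearMap.coe_mk, AddHom.coe_mk, Pi.zero_apply,
    sub_eq_zero]

lemma netFlow_single (src tgt : E → V) (e : E) :
    netFlow src tgt k (Pi.single e 1) = Pi.single (tgt e) 1 - Pi.single (src e) 1 := by
  have key : ∀ (h : E → V) (v : V),
      (∑ f, if h f = v then (Pi.single e 1 : E → ZMod k) f else 0) =
        (Pi.single (h e) 1 : V → ZMod k) v := by
    intro h v
    rw [Finset.sum_eq_single e]
    · simp [Pi.single_apply, eq_comm]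
    · intro f _ hf
      simp [Pi.single_eq_of_ne hf]
    · simp
  ext v
  simp only [netFlow, LinearMap.coe_mk, AddHom.coe_mk, key, Pi.sub_apply]

lemma exists_netFlow_eq {src tgt : E → V} {S : Set E} {a b : V}
    (h : EqvGen (linkRel src tgt S) a b) :
    ∃ g : E → ZMod k, (∀ e ∉ S, g e = 0) ∧
      netFlow src tgt k g = Pi.single b 1 - Pi.single a 1 := by
  induction h with
  | rel a b hr =>
    obtain ⟨e, he, rfl, rfl⟩ := hr
    refine ⟨Pi.single e 1, fun f hf => Pi.single_eq_of_ne ?_ _, netFlow_single ..⟩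
    rintro rfl
    exact hf he
  | refl a => exact ⟨0, by simp, by simp⟩
  | symm a b _ ih =>
    obtain ⟨g, hg, hn⟩ := ih
    exact ⟨-g, by simpa using hg, by rw [map_neg, hn, neg_sub]⟩
  | trans a b c _ _ ih1 ih2 =>
    obtain ⟨g, hg, hn⟩ := ih1
    obtain ⟨g', hg', hn'⟩ := ih2
    refine ⟨g + g', fun e he => by simp [hg e he, hg' e he], ?_⟩
    rw [map_add, hn, hn']
    abel

/-- The number of flows supported on `S`. -/
noncomputable def flowCountOn (src tgt : E → V) (k : ℕ) (S : Finset E) : ℕ :=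
  Nat.card {f : E → ZMod k // IsFlow src tgt k f ∧ ∀ e ∉ S, f e = 0}

lemma flowCountOn_empty (src tgt : E → V) (k : ℕ) : flowCountOn src tgt k ∅ = 1 := by
  rw [flowCountOn, Nat.card_eq_one_iff_unique]
  refine ⟨⟨fun f g => Subtype.ext (funext fun e => ?_)⟩, ⟨0, ?_, by simp⟩⟩
  · rw [f.2.2 e (by simp), g.2.2 e (by simp)]
  · rw [isFlow_iff, map_zero]

lemma flowCountOn_insert_of_eqvGen {src tgt : E → V} {S : Finset E} {e : E} (he : e ∉ S)
    (h : EqvGen (linkRel src tgt S) (src e) (tgt e)) :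
    flowCountOn src tgt k (insert e S) = k * flowCountOn src tgt k S := by
  obtain ⟨g, hg, hn⟩ := exists_netFlow_eq (k := k) (h.symm _ _)
  have hge : g e = 0 := hg e he
  let c : E → ZMod k := Pi.single e 1 + g
  have hce : c e = 1 := by simp [c, hge]
  have hcf : ∀ f ∉ insert e S, c f = 0 := by
    intro f hf
    rw [Finset.mem_insert, not_or] at hf
    simp [c, Pi.single_eq_of_ne hf.1, hg f hf.2]
  have hc : netFlow src tgt k c = 0 := by
    rw [map_add, netFlow_single, hn]
    abel
  have equiv : {f : E → ZMod k // IsFlow src tgt k f ∧ ∀ e' ∉ insert e S, f e' = 0} ≃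
      ZMod k × {f : E → ZMod k // IsFlow src tgt k f ∧ ∀ e ∉ S, f e = 0} :=
    { toFun := fun f => (f.1 e, ⟨f.1 - f.1 e • c, by
        rw [isFlow_iff, map_sub, map_smul, hc, (isFlow_iff ..).1 f.2.1, smul_zero, sub_zero], by
        intro e' he'
        by_cases hee : e' = e
        · subst hee
          simp [hce]
        · have hmem : e' ∉ insert e S := by simp [hee, he']
          simp [f.2.2 e' hmem, hcf e' hmem]⟩)
      invFun := fun p => ⟨p.2.1 + p.1 • c, by
        rw [isFlow_iff, map_add, map_smul, hc, (isFlow_iff ..).1 p.2.2.1, smul_zero, add_zero], by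
        intro e' he'
        simp [p.2.2.2 e' fun hS => he' (Finset.mem_insert_of_mem hS), hcf e' he']⟩
      left_inv := fun f => by simp
      right_inv := fun p => by
        have hp : p.2.1 e = 0 := p.2.2.2 e he
        ext <;> simp [hp, hce] }
  rw [flowCountOn, Nat.card_congr equiv, Nat.card_prod, Nat.card_zmod, flowCountOn]

lemma apply_eq_zero_of_not_eqvGen [Fintype V] {src tgt : E → V} {S : Finset E} {e : E}
    (h : ¬ EqvGen (linkRel src tgt S) (src e) (tgt e)) {f : E → ZMod k}
    (hf : IsFlow src tgt k f) (hS : ∀ e' ∉ insert e S, f e' = 0) : f e = 0 := by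
  let K : Finset V := {v | EqvGen (linkRel src tgt S) (src e) v}
  have key : ∀ p : E → V, ∑ v ∈ K, (∑ e', if p e' = v then f e' else 0) =
      ∑ e', if p e' ∈ K then f e' else 0 := by
    intro p
    rw [Finset.sum_comm]
    refine Finset.sum_congr rfl fun e' _ => ?_
    rw [Finset.sum_ite_eq]
  have hsum : (∑ e', if tgt e' ∈ K then f e' else 0) = ∑ e', if src e' ∈ K then f e' else 0 := by
    rw [← key, ← key]
    exact Finset.sum_congr rfl fun v _ => hf v
  rw [eq_comm, ← sub_eq_zero, ← Finset.sum_sub_distrib, Finset.sum_eq_single e] at hsum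
  · simpa [K, h, EqvGen.refl] using hsum
  · intro e' _ hne
    by_cases he' : e' ∈ S
    · have hiff : src e' ∈ K ↔ tgt e' ∈ K := by
        have hl : EqvGen (linkRel src tgt S) (src e') (tgt e') := .rel _ _ ⟨e', he', rfl, rfl⟩
        simp only [K, Finset.mem_filter, Finset.mem_univ, true_and]
        exact ⟨fun h => h.trans _ _ _ hl, fun h => h.trans _ _ _ (hl.symm _ _)⟩
      simp [hiff]
    · simp [hS e' (by simp [hne, he'])]
  · simp

lemma flowCountOn_insert_of_not_eqvGen [Fintype V] {src tgt : E → V} {S : Finset E} {e : E}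
    (h : ¬ EqvGen (linkRel src tgt S) (src e) (tgt e)) :
    flowCountOn src tgt k (insert e S) = flowCountOn src tgt k S := by
  refine Nat.card_congr (Equiv.subtypeEquivRight fun f => and_congr_right fun hf => ?_)
  constructor
  · intro hS e' he'
    by_cases hee : e' = e
    · rw [hee]
      exact apply_eq_zero_of_not_eqvGen h hf hS
    · exact hS e' (by simp [hee, he'])
  · exact fun hS e' he' => hS e' fun h => he' (Finset.mem_insert_of_mem h)

lemma flowCountOn_eq_pow [Fintype V] (src tgt : E → V) (k : ℕ) (S : Finset E) :
    flowCountOn src tgt k S = k ^ subXi src tgt S := by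
  induction S using Finset.induction_on with
  | empty => simp [flowCountOn_empty, subXi, ncompSub_empty]
  | insert e S he ih =>
    have hle := card_le_card_add_ncompSub src tgt S
    by_cases h : EqvGen (linkRel src tgt S) (src e) (tgt e)
    · rw [flowCountOn_insert_of_eqvGen he h, ih, ← pow_succ']
      congr 1
      rw [subXi, subXi, Finset.card_insert_of_notMem he, Finset.coe_insert,
        ncompSub_insert_of_eqvGen h]
      omega
    · rw [flowCountOn_insert_of_not_eqvGen h, ih]
      congr 1
      have := ncompSub_insert_of_not_eqvGen h
      rw [subXi, subXi, Finset.card_insert_of_notMem he, Finset.coe_insert]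
      omega

/-- The zero set of `f`. -/
noncomputable def zeroSet (f : E → ZMod k) : Finset E := {e | f e = 0}

lemma mem_zeroSet {f : E → ZMod k} {e : E} : e ∈ zeroSet f ↔ f e = 0 := by
  simp [zeroSet]

lemma sum_flows_sum_powerset_zeroSet [Fintype V] [NeZero k] (src tgt : E → V)
    (g : Finset E → ℤ) :
    ∑ f : E → ZMod k, (if IsFlow src tgt k f then ∑ T ∈ (zeroSet f).powerset, g T else 0) =
      ∑ T, g T * (k : ℤ) ^ subXi src tgt Tᶜ := by
  have h1 : ∀ f : E → ZMod k,
      (if IsFlow src tgt k f then ∑ T ∈ (zeroSet f).powerset, g T else 0) =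
        ∑ T, if IsFlow src tgt k f ∧ ∀ e ∉ Tᶜ, f e = 0 then g T else 0 := by
    intro f
    by_cases hf : IsFlow src tgt k f
    · simp only [hf, true_and, if_true]
      rw [← Finset.sum_filter]
      refine Finset.sum_congr ?_ fun _ _ => rfl
      ext T
      simp [Finset.subset_iff, mem_zeroSet]
    · simp [hf]
  simp only [h1]
  rw [Finset.sum_comm]
  refine Finset.sum_congr rfl fun T _ => ?_
  have h2 : (Finset.univ.filter fun f : E → ZMod k =>
      IsFlow src tgt k f ∧ ∀ e ∉ Tᶜ, f e = 0).card = k ^ subXi src tgt Tᶜ := by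
    rw [← flowCountOn_eq_pow, flowCountOn, Nat.card_eq_fintype_card, Fintype.card_subtype]
  rw [← Finset.sum_filter, Finset.sum_const, h2, nsmul_eq_mul, mul_comm]
  push_cast
  rfl

lemma nzFlowCount_eq_sum [Fintype V] [NeZero k] (src tgt : E → V) :
    (nzFlowCount src tgt k : ℤ) =
      ∑ T : Finset E, (-1) ^ T.card * (k : ℤ) ^ subXi src tgt Tᶜ := by
  rw [← sum_flows_sum_powerset_zeroSet, nzFlowCount, Nat.card_eq_fintype_card,
    Fintype.card_subtype, Finset.card_filter, Nat.cast_sum]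
  refine Finset.sum_congr rfl fun f _ => ?_
  rw [Finset.sum_powerset_neg_one_pow_card]
  have : zeroSet f = ∅ ↔ ∀ e, f e ≠ 0 := by
    simp [Finset.eq_empty_iff_forall_notMem, mem_zeroSet]
  simp only [this]
  split_ifs <;> first | rfl | tauto

lemma card_pairs_eq_sum_tcCount [NeZero k] (src tgt : E → V) :
    (Nat.card {p : (E → ZMod k) × Set E //
        IsFlow src tgt k p.1 ∧ p.2 ⊆ {e | p.1 e = 0} ∧
        TCReorContr src tgt {e | p.1 e ≠ 0} p.2} : ℤ) =
      ∑ f : E → ZMod k,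
        if IsFlow src tgt k f then tcCount src tgt (zeroSet f) (zeroSet f)ᶜ else 0 := by
  rw [Nat.card_eq_fintype_card, Fintype.card_subtype, Finset.card_filter, Nat.cast_sum,
    Fintype.sum_prod_type]
  refine Finset.sum_congr rfl fun f _ => ?_
  by_cases hf : IsFlow src tgt k f
  · simp only [hf, true_and, if_true]
    rw [← Equiv.sum_comp Fintype.finsetEquivSet, tcCount]
    have hZ : ((zeroSet f : Finset E) : Set E) = {e | f e ≠ 0}ᶜ := by
      ext e
      simp [mem_zeroSet]
    have hZc : (((zeroSet f)ᶜ : Finset E) : Set E) = {e | f e ≠ 0} := by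
      rw [Finset.coe_compl, hZ, compl_compl]
    have hsub : (zeroSet f).powerset =
        Finset.univ.filter fun σ : Finset E => (σ : Set E) ⊆ {e | f e = 0} := by
      ext σ
      simp [Finset.subset_iff, mem_zeroSet, Set.subset_def]
    rw [hsub, Finset.sum_filter]
    refine Finset.sum_congr rfl fun σ _ => ?_
    rw [hZ, hZc, ← tcReorContr_iff, Fintype.finsetEquivSet_apply]
    split_ifs <;> first | rfl | tauto
  · simp [hf]

lemma card_pairs_eq_sum [Fintype V] [NeZero k] (src tgt : E → V) :
    (Nat.card {p : (E → ZMod k) × Set E //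
        IsFlow src tgt k p.1 ∧ p.2 ⊆ {e | p.1 e = 0} ∧
        TCReorContr src tgt {e | p.1 e ≠ 0} p.2} : ℤ) =
      ∑ T : Finset E, (-1) ^ (ncompSub src tgt (Tᶜ : Finset E) + ncomp src tgt) *
        (k : ℤ) ^ subXi src tgt Tᶜ := by
  rw [card_pairs_eq_sum_tcCount, ← sum_flows_sum_powerset_zeroSet]
  refine Finset.sum_congr rfl fun f _ => ?_
  congr 1
  rw [tcCount_eq_sum, Finset.union_compl, Finset.coe_univ, ← ncomp]
  refine Finset.sum_nbij' (fun S => zeroSet f \ S) (fun S => zeroSet f \ S)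
    (by simp) (by simp) (by simp) (by simp) ?_
  intro S hS
  rw [Finset.mem_powerset] at hS
  have hcompl : S ∪ (zeroSet f)ᶜ = (zeroSet f \ S)ᶜ := by
    ext e
    have := @hS e
    simp only [Finset.mem_union, Finset.mem_compl, Finset.mem_sdiff]
    tauto
  rw [hcompl]

end Flows

/-- **Modular flow reciprocity.** For the modular flow polynomial `P = φ̄_G`,
`(-1)^{ξ(G)} P(-k)` counts the pairs `(f, σ)` of a `ZMod k`-flow `f` and a
totally cyclic reorientation `σ ⊆ E ∖ supp f` of the contraction `G/supp f`. -/
theorem modular_flow_reciprocity {V E : Type} [Fintype V] [Fintype E]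
    (src tgt : E → V) (k : ℕ) (hk : 0 < k) (P : Polynomial ℚ)
    (hP : ∀ m : ℕ, 0 < m → P.eval (m : ℚ) = nzFlowCount src tgt m) :
    (-1 : ℚ) ^ (xi src tgt) * P.eval (-(k : ℚ)) =
      Nat.card {p : (E → ZMod k) × Set E //
        IsFlow src tgt k p.1 ∧ p.2 ⊆ {e | p.1 e = 0} ∧
        TCReorContr src tgt {e | p.1 e ≠ 0} p.2} := by
  have : NeZero k := ⟨hk.ne'⟩
  let Q : Polynomial ℚ := ∑ T : Finset E,
    Polynomial.C ((-1) ^ T.card) * Polynomial.X ^ subXi src tgt Tᶜ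
  have hQ : ∀ x : ℚ, Q.eval x = ∑ T : Finset E, (-1) ^ T.card * x ^ subXi src tgt Tᶜ := by
    intro x
    simp [Q, Polynomial.eval_finsetSum]
  have hPQ : P = Q := by
    refine Polynomial.eq_of_infinite_eval_eq P Q
      (Set.Infinite.mono ?_ (Set.infinite_range_of_injective
        (f := fun n : ℕ => ((n + 1 : ℕ) : ℚ)) fun a b h => by simpa using h))
    rintro _ ⟨n, rfl⟩
    change P.eval _ = Q.eval _
    rw [hP (n + 1) n.succ_pos, hQ]
    have h := nzFlowCount_eq_sum (k := n + 1) src tgt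
    simpa using congrArg (Int.cast : ℤ → ℚ) h
  have hxi : xi src tgt = (subXi src tgt (Finset.univ : Finset E) : ℤ) := by
    have h := card_le_card_add_ncompSub src tgt (Finset.univ : Finset E)
    rw [subXi, Nat.cast_sub h, Finset.coe_univ, xi, ncomp, Finset.card_univ]
    push_cast
    ring
  have hR := congrArg (Int.cast : ℤ → ℚ) (card_pairs_eq_sum (k := k) src tgt)
  simp only [Int.cast_natCast, Int.cast_sum, Int.cast_mul, Int.cast_pow, Int.cast_neg,
    Int.cast_one] at hR
  rw [hR, hPQ, hQ, hxi, zpow_natCast, Finset.mul_sum]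
  refine Finset.sum_congr rfl fun T _ => ?_
  rw [neg_pow (k : ℚ), ← mul_assoc, ← mul_assoc, ← pow_add, ← pow_add]
  congr 1
  have h1 := card_le_card_add_ncompSub src tgt (Finset.univ : Finset E)
  have h2 := card_le_card_add_ncompSub src tgt Tᶜ
  have h3 := Finset.card_add_card_compl T
  rw [Finset.card_univ] at h1
  refine neg_one_pow_congr ?_
  rw [subXi, subXi, ncomp, ← Finset.coe_univ, Finset.card_univ, Nat.even_iff, Nat.even_iff]
  omega

end ModularFlows
end

section
/- Let G = (V,E) be an oriented graph. Then (−1)^{ξ(G)} · φ̄_G(−1) equals the number of subsets σ ⊆ E that are totally cyclic reorientations of G. -/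
namespace ModularFlows

attribute [local instance] Classical.propDecidable

variable {V E : Type}

/-! ### Sign patterns realised by a linear subspace -/

section SignPatterns

variable {E : Type}

/-- The vectors vanishing on `S`. -/
def vanishingOn (K : Type) [Field K] (S : Finset E) : Submodule K (E → K) where
  carrier := {f | ∀ e ∈ S, f e = 0}
  add_mem' := fun {f g} hf hg e he => by simp [hf e he, hg e he]
  zero_mem' := fun _ _ => rfl
  smul_mem' := fun c f hf e he => by simp [hf e he]

theorem mem_vanishingOn {K : Type} [Field K] {S : Finset E} {f : E → K} :
    f ∈ vanishingOn K S ↔ ∀ e ∈ S, f e = 0 := Iff.rfl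

/-- Some vector of `W` is negative on `σ` and positive on the rest of `T`. -/
def Realises (W : Submodule ℚ (E → ℚ)) (T σ : Finset E) : Prop :=
  ∃ w ∈ W, ∀ e ∈ T, if e ∈ σ then w e < 0 else 0 < w e

theorem exists_small_perturbation (T σ : Finset E) (w u : E → ℚ)
    (hw : ∀ e ∈ T, if e ∈ σ then w e < 0 else 0 < w e) :
    ∃ ε : ℚ, 0 < ε ∧ ∀ e ∈ T, if e ∈ σ then w e + ε * u e < 0 else 0 < w e + ε * u e := by
  induction T using Finset.induction_on with
  | empty => exact ⟨1, one_pos, by simp⟩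
  | insert a T ha ih =>
    obtain ⟨ε, hε, h⟩ := ih fun e he => hw e (Finset.mem_insert_of_mem he)
    have hwa := hw a (Finset.mem_insert_self a T)
    have hwa0 : w a ≠ 0 := by
      split_ifs at hwa
      · exact hwa.ne
      · exact hwa.ne'
    have hd : 0 < 1 + |u a| := by positivity
    set δ := |w a| / (2 * (1 + |u a|)) with hδ
    have hδpos : 0 < δ := by positivity
    have hδmul : δ * (1 + |u a|) = |w a| / 2 := by rw [hδ]; field_simp
    refine ⟨min ε δ, lt_min hε hδpos, fun e he => ?_⟩
    have hm := lt_min hε hδpos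
    rcases Finset.mem_insert.1 he with rfl | he
    · have h1 : |min ε δ * u e| < |w e| := by
        rw [abs_mul, abs_of_pos hm]
        have := mul_le_mul_of_nonneg_right (min_le_right ε δ) (abs_nonneg (u e))
        have := abs_pos.2 hwa0
        nlinarith
      have h2 := abs_lt.1 h1
      split_ifs at hwa ⊢
      · rw [abs_of_neg hwa] at h2; linarith
      · rw [abs_of_pos hwa] at h2; linarith
    · have h1 := h e he
      have h0 := hw e (Finset.mem_insert_of_mem he)
      have h2 := min_le_left ε δ
      split_ifs at h1 h0 ⊢
      · rcases le_total 0 (u e) with hu | hu <;> nlinarith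
      · rcases le_total 0 (u e) with hu | hu <;> nlinarith

theorem realises_mono {W W' : Submodule ℚ (E → ℚ)} (h : W ≤ W') {T T' σ : Finset E}
    (hT : T' ⊆ T) (hσ : Realises W T σ) : Realises W' T' σ := by
  obtain ⟨w, hw, hs⟩ := hσ
  exact ⟨w, h hw, fun e he => hs e (hT he)⟩

theorem realises_insert_pos_iff {W : Submodule ℚ (E → ℚ)} {T σ : Finset E} {a : E}
    (ha : a ∉ σ) :
    Realises W (insert a T) σ ↔
      ∃ w ∈ W, 0 < w a ∧ ∀ e ∈ T, if e ∈ σ then w e < 0 else 0 < w e := by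
  simp [Realises, ha]

theorem realises_insert_neg_iff {W : Submodule ℚ (E → ℚ)} {T σ : Finset E} {a : E}
    (ha : a ∉ T) :
    Realises W (insert a T) (insert a σ) ↔
      ∃ w ∈ W, w a < 0 ∧ ∀ e ∈ T, if e ∈ σ then w e < 0 else 0 < w e := by
  have key : ∀ w : E → ℚ, (∀ e ∈ T, if e ∈ insert a σ then w e < 0 else 0 < w e) ↔
      ∀ e ∈ T, if e ∈ σ then w e < 0 else 0 < w e := fun w =>
    forall₂_congr fun e he => by
      have : e ≠ a := fun h => ha (h ▸ he)
      simp [this]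
  simp only [Realises, Finset.forall_mem_insert, key, Finset.mem_insert_self, if_true]

theorem realises_vanishing_iff {W : Submodule ℚ (E → ℚ)} {T σ : Finset E} {a : E} :
    Realises (W ⊓ vanishingOn ℚ {a}) T σ ↔
      ∃ w ∈ W, w a = 0 ∧ ∀ e ∈ T, if e ∈ σ then w e < 0 else 0 < w e := by
  simp [Realises, mem_vanishingOn, and_assoc]

theorem indicator_add_indicator {p q r s : Prop} (hp : p → r) (hq : q → r)
    (hr : r → p ∨ q ∨ s) (hpq : p → q → s) (hsp : s → p) (hsq : s → q) :
    ((if p then 1 else 0 : ℚ) + if q then 1 else 0) =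
      (if r then 1 else 0) + if s then 1 else 0 := by
  by_cases p <;> by_cases q <;> by_cases r <;> by_cases s <;> simp_all

/-- Crossing one hyperplane: the two sides of `x_a = 0` inside an open cell are both
realised exactly when the cell meets the hyperplane. -/
theorem realises_insert_count {W : Submodule ℚ (E → ℚ)} {T σ : Finset E} {a : E}
    (ha : a ∉ T) (hσ : σ ⊆ T) (hW : ∃ u ∈ W, u a ≠ 0) :
    ((if Realises W (insert a T) σ then 1 else 0 : ℚ) +
        if Realises W (insert a T) (insert a σ) then 1 else 0) =
      (if Realises W T σ then 1 else 0) +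
        if Realises (W ⊓ vanishingOn ℚ {a}) T σ then 1 else 0 := by
  have haσ : a ∉ σ := fun h => ha (hσ h)
  have hp := realises_insert_pos_iff (W := W) (T := T) haσ
  have hn := realises_insert_neg_iff (W := W) (σ := σ) ha
  have hz := realises_vanishing_iff (W := W) (T := T) (σ := σ) (a := a)
  have h1 : Realises W (insert a T) σ → Realises W T σ :=
    realises_mono le_rfl (Finset.subset_insert a T)
  have h2 : Realises W (insert a T) (insert a σ) → Realises W T σ := by
    rw [hn]; rintro ⟨w, hw, -, h⟩; exact ⟨w, hw, h⟩
  have h3 : Realises W T σ → Realises W (insert a T) σ ∨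
      Realises W (insert a T) (insert a σ) ∨ Realises (W ⊓ vanishingOn ℚ {a}) T σ := by
    rintro ⟨w, hw, h⟩
    rw [hp, hn, hz]
    rcases lt_trichotomy (w a) 0 with h0 | h0 | h0
    · exact .inr (.inl ⟨w, hw, h0, h⟩)
    · exact .inr (.inr ⟨w, hw, h0, h⟩)
    · exact .inl ⟨w, hw, h0, h⟩
  have h4 : Realises W (insert a T) σ → Realises W (insert a T) (insert a σ) →
      Realises (W ⊓ vanishingOn ℚ {a}) T σ := by
    rw [hp, hn, hz]
    rintro ⟨w, hw, hwa, h⟩ ⟨x, hx, hxa, h'⟩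
    refine ⟨(-x a) • w + w a • x, W.add_mem (W.smul_mem _ hw) (W.smul_mem _ hx), ?_,
      fun e he => ?_⟩
    · simp; ring
    · have e1 := h e he
      have e2 := h' e he
      simp only [Pi.add_apply, Pi.smul_apply, smul_eq_mul]
      split_ifs at e1 e2 ⊢ <;> nlinarith
  have h5 : ∀ u ∈ W, Realises (W ⊓ vanishingOn ℚ {a}) T σ →
      ∃ w ∈ W, ∃ ε : ℚ, 0 < ε ∧ w a = ε * u a ∧
        ∀ e ∈ T, if e ∈ σ then w e < 0 else 0 < w e := by
    intro u hu
    rw [hz]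
    rintro ⟨w, hw, hwa, h⟩
    obtain ⟨ε, hε, h'⟩ := exists_small_perturbation T σ w u h
    exact ⟨w + ε • u, W.add_mem hw (W.smul_mem _ hu), ε, hε, by simp [hwa],
      by simpa using h'⟩
  obtain ⟨u, hu, hua⟩ : ∃ u ∈ W, 0 < u a := by
    obtain ⟨u, hu, hua⟩ := hW
    rcases lt_or_gt_of_ne hua with h | h
    · exact ⟨-u, W.neg_mem hu, by simpa using h⟩
    · exact ⟨u, hu, h⟩
  have h6 : Realises (W ⊓ vanishingOn ℚ {a}) T σ → Realises W (insert a T) σ := by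
    intro h
    obtain ⟨w, hw, ε, hε, hwa, h'⟩ := h5 u hu h
    exact hp.2 ⟨w, hw, by rw [hwa]; positivity, h'⟩
  have h7 : Realises (W ⊓ vanishingOn ℚ {a}) T σ →
      Realises W (insert a T) (insert a σ) := by
    intro h
    obtain ⟨w, hw, ε, hε, hwa, h'⟩ := h5 (-u) (W.neg_mem hu) h
    refine hn.2 ⟨w, hw, ?_, h'⟩
    rw [hwa]
    simpa using mul_pos hε hua
  exact indicator_add_indicator h1 h2 h3 h4 h6 h7

theorem finrank_inf_vanishingOn_singleton [Finite E] {W : Submodule ℚ (E → ℚ)} {a : E}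
    (hW : ∃ u ∈ W, u a ≠ 0) :
    Module.finrank ℚ (W ⊓ vanishingOn ℚ {a} : Submodule ℚ (E → ℚ)) + 1 =
      Module.finrank ℚ W := by
  let φ : W →ₗ[ℚ] ℚ := (LinearMap.proj a).comp W.subtype
  have hrange : LinearMap.range φ = ⊤ := by
    rw [LinearMap.range_eq_top]
    apply LinearMap.surjective
    obtain ⟨u, hu, hua⟩ := hW
    intro h
    exact hua (by simpa [φ] using congrArg (fun ψ : W →ₗ[ℚ] ℚ => ψ ⟨u, hu⟩) h)
  have h := LinearMap.finrank_range_add_finrank_ker φ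
  rw [hrange, finrank_top, Module.finrank_self] at h
  have hker : Module.finrank ℚ (LinearMap.ker φ) =
      Module.finrank ℚ (W ⊓ vanishingOn ℚ {a} : Submodule ℚ (E → ℚ)) := by
    rw [← LinearMap.finrank_range_of_inj (f := W.subtype.comp (LinearMap.ker φ).subtype)
      (W.injective_subtype.comp (LinearMap.ker φ).injective_subtype)]
    have hrange' : LinearMap.range (W.subtype.comp (LinearMap.ker φ).subtype) =
        W ⊓ vanishingOn ℚ {a} := by
      ext f
      simp [φ, mem_vanishingOn]
      tauto
    rw [hrange']
  omega

theorem vanishingOn_insert {K : Type} [Field K] (a : E) (S : Finset E) :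
    vanishingOn K (insert a S) = vanishingOn K {a} ⊓ vanishingOn K S := by
  ext f
  simp [mem_vanishingOn]

/-- Zaslavsky's theorem for the coordinate hyperplanes restricted to a subspace. -/
theorem sum_realises [Finite E] (T : Finset E) (W : Submodule ℚ (E → ℚ)) :
    (-1 : ℚ) ^ Module.finrank ℚ W * ∑ σ ∈ T.powerset, (if Realises W T σ then 1 else 0) =
      ∑ S ∈ T.powerset, (-1 : ℚ) ^ S.card *
        (-1) ^ Module.finrank ℚ (W ⊓ vanishingOn ℚ S : Submodule ℚ (E → ℚ)) := by
  induction T using Finset.induction_on generalizing W with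
  | empty =>
    have h0 : W ⊓ vanishingOn ℚ ∅ = W := inf_eq_left.2 fun f _ => by simp [mem_vanishingOn]
    have h1 : Realises W ∅ ∅ := ⟨0, W.zero_mem, by simp⟩
    rw [Finset.powerset_empty, Finset.sum_singleton, Finset.sum_singleton, if_pos h1, h0]
    simp
  | insert a T ha ih =>
    rw [Finset.sum_powerset_insert ha, Finset.sum_powerset_insert ha, ← ih W]
    have hS : ∑ S ∈ T.powerset, (-1 : ℚ) ^ (insert a S).card *
        (-1) ^ Module.finrank ℚ (W ⊓ vanishingOn ℚ (insert a S) : Submodule ℚ (E → ℚ)) =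
        -((-1 : ℚ) ^ Module.finrank ℚ (W ⊓ vanishingOn ℚ {a} : Submodule ℚ (E → ℚ)) *
          ∑ σ ∈ T.powerset, if Realises (W ⊓ vanishingOn ℚ {a}) T σ then 1 else 0) := by
      rw [ih, ← Finset.sum_neg_distrib]
      refine Finset.sum_congr rfl fun S hS => ?_
      rw [Finset.card_insert_of_notMem fun h => ha (Finset.mem_powerset.1 hS h),
        vanishingOn_insert, inf_assoc, pow_succ]
      ring
    rw [hS]
    by_cases hW : ∃ u ∈ W, u a ≠ 0
    · rw [← Finset.sum_add_distrib, Finset.sum_congr rfl fun σ hσ =>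
        realises_insert_count ha (Finset.mem_powerset.1 hσ) hW, Finset.sum_add_distrib,
        ← finrank_inf_vanishingOn_singleton hW, pow_succ]
      ring
    · have hW' : ∀ u ∈ W, u a = 0 := by simpa using hW
      have h0 : W ⊓ vanishingOn ℚ {a} = W :=
        inf_eq_left.2 fun f hf => by simpa [mem_vanishingOn] using hW' f hf
      have h1 : ∀ σ, ¬ Realises W (insert a T) σ := by
        rintro σ ⟨w, hw, h⟩
        have := h a (Finset.mem_insert_self a T)
        simp [hW' w hw] at this
      rw [h0]
      simp [h1]

end SignPatterns

/-! ### The space of flows -/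

section Flows

variable {V E : Type}

/-- The incidence matrix over a field. -/
noncomputable def incMatrix (K : Type) [Field K] (src tgt : E → V) : Matrix V E K :=
  Matrix.of fun v e => (if tgt e = v then 1 else 0) - (if src e = v then 1 else 0)

/-- The incidence matrix, with a coordinate row added for each edge of `S`. -/
noncomputable def incMatrixExt (K : Type) [Field K] (src tgt : E → V) (S : Finset E) :
    Matrix (V ⊕ S) E K :=
  Matrix.of fun r e => Sum.elim (fun v => incMatrix K src tgt v e)
    (fun s => if e = s.1 then 1 else 0) r

theorem finrank_ker_incMatrixExt_transpose [Fintype V] (K : Type) [Field K] (src tgt : E → V)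
    (S : Finset E) :
    Module.finrank K (LinearMap.ker (incMatrixExt K src tgt S).transpose.mulVecLin) =
      ncompSub src tgt (Set.univ \ S) := by
  set Q := Quot (linkRel src tgt (Set.univ \ S))
  have : Finite Q := Quot.finite _
  have : Fintype Q := Fintype.ofFinite Q
  let L : (Q → K) →ₗ[K] (V ⊕ S → K) :=
    { toFun := fun g => Sum.elim (fun v => g (Quot.mk _ v))
        (fun s => g (Quot.mk _ (src s.1)) - g (Quot.mk _ (tgt s.1)))
      map_add' := fun g h => by
        ext (v | s)
        · simp
        · simp; ring
      map_smul' := fun c g => by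
        ext (v | s)
        · simp
        · simp; ring }
  have hL : Function.Injective L := by
    intro g h hgh
    ext ⟨v⟩
    exact congrFun hgh (Sum.inl v)
  have hmem : ∀ x : V ⊕ S → K,
      x ∈ LinearMap.ker (incMatrixExt K src tgt S).transpose.mulVecLin ↔
      ∀ e, x (Sum.inl (tgt e)) - x (Sum.inl (src e)) +
        (if h : e ∈ S then x (Sum.inr ⟨e, h⟩) else 0) = 0 := by
    intro x
    rw [LinearMap.mem_ker, funext_iff]
    refine forall_congr' fun e => ?_
    have : ∑ s : S, (if e = s.1 then x (Sum.inr s) else 0) =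
        if h : e ∈ S then x (Sum.inr ⟨e, h⟩) else 0 := by
      split_ifs with h
      · rw [Finset.sum_eq_single ⟨e, h⟩]
        · simp
        · intro s _ hs
          rw [if_neg]
          rintro rfl
          exact hs rfl
        · simp
      · refine Finset.sum_eq_zero fun s _ => if_neg ?_
        rintro rfl
        exact h s.2
    simp [Matrix.vecMul, dotProduct, incMatrixExt, incMatrix, mul_sub, this, -Finset.univ_eq_attach]
  have hrange : LinearMap.range L =
      LinearMap.ker (incMatrixExt K src tgt S).transpose.mulVecLin := by
    ext x
    rw [hmem]
    constructor
    · rintro ⟨g, rfl⟩ e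
      by_cases h : e ∈ S
      · simp [L, h]
      · have : Quot.mk (linkRel src tgt (Set.univ \ S)) (src e) = Quot.mk _ (tgt e) :=
          Quot.sound ⟨e, by simpa using h, rfl, rfl⟩
        simp [L, h, this]
    · intro hx
      refine ⟨Quot.lift (fun v => x (Sum.inl v)) ?_, ?_⟩
      · rintro _ _ ⟨e, he, rfl, rfl⟩
        have := hx e
        rw [dif_neg (by simpa using he)] at this
        linear_combination -this
      · ext (v | ⟨s, hs⟩)
        · rfl
        · have := hx s
          rw [dif_pos hs] at this
          change x (Sum.inl (src s)) - x (Sum.inl (tgt s)) = _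
          linear_combination -this
  rw [← hrange, LinearMap.finrank_range_of_inj hL, Module.finrank_fintype_fun_eq_card,
    ncompSub, Nat.card_eq_fintype_card]

variable [Fintype E]

/-- The space of flows over a field. -/
noncomputable def flowSpace (K : Type) [Field K] (src tgt : E → V) : Submodule K (E → K) :=
  LinearMap.ker (incMatrix K src tgt).mulVecLin

theorem mem_flowSpace {K : Type} [Field K] {src tgt : E → V} {f : E → K} :
    f ∈ flowSpace K src tgt ↔ ∀ v : V,
      (∑ e : E, if tgt e = v then f e else 0) = ∑ e : E, if src e = v then f e else 0 := by
  rw [flowSpace, LinearMap.mem_ker, funext_iff]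
  refine forall_congr' fun v => ?_
  conv_rhs => rw [← sub_eq_zero, ← Finset.sum_sub_distrib]
  simp only [Matrix.mulVecLin_apply, Matrix.mulVec, dotProduct, incMatrix, Matrix.of_apply,
    sub_mul, ite_mul, one_mul, zero_mul, Pi.zero_apply]

theorem ker_incMatrixExt (K : Type) [Field K] (src tgt : E → V) (S : Finset E) :
    LinearMap.ker (incMatrixExt K src tgt S).mulVecLin =
      flowSpace K src tgt ⊓ vanishingOn K S := by
  ext f
  simp [flowSpace, mem_vanishingOn, funext_iff, Matrix.mulVec, dotProduct, incMatrixExt]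

theorem finrank_flowSpace_inf [Fintype V] (K : Type) [Field K] (src tgt : E → V) (S : Finset E) :
    Module.finrank K (flowSpace K src tgt ⊓ vanishingOn K S : Submodule K (E → K)) +
      Fintype.card V + S.card = Fintype.card E + ncompSub src tgt (Set.univ \ S) := by
  have h1 := LinearMap.finrank_range_add_finrank_ker (incMatrixExt K src tgt S).mulVecLin
  have h2 := LinearMap.finrank_range_add_finrank_ker
    (incMatrixExt K src tgt S).transpose.mulVecLin
  have h3 := (incMatrixExt K src tgt S).rank_transpose
  rw [ker_incMatrixExt] at h1
  rw [finrank_ker_incMatrixExt_transpose] at h2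
  simp only [Matrix.rank, Module.finrank_fintype_fun_eq_card, Fintype.card_sum,
    Fintype.card_coe] at h1 h2 h3
  omega

theorem nzFlowCount_prime [Fintype V] (src tgt : E → V) (p : ℕ) [Fact p.Prime] :
    (nzFlowCount src tgt p : ℚ) = ∑ S : Finset E, (-1 : ℚ) ^ S.card *
      (p : ℚ) ^ Module.finrank ℚ (flowSpace ℚ src tgt ⊓ vanishingOn ℚ S :
        Submodule ℚ (E → ℚ)) := by
  have hcard : ∀ S : Finset E,
      (∑ f : E → ZMod p, if f ∈ flowSpace (ZMod p) src tgt ⊓ vanishingOn (ZMod p) S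
        then (1 : ℚ) else 0) =
      (p : ℚ) ^ Module.finrank ℚ (flowSpace ℚ src tgt ⊓ vanishingOn ℚ S :
        Submodule ℚ (E → ℚ)) := by
    intro S
    have h1 := finrank_flowSpace_inf ℚ src tgt S
    have h2 := finrank_flowSpace_inf (ZMod p) src tgt S
    have h3 := Module.card_eq_pow_finrank (K := ZMod p)
      (V := (flowSpace (ZMod p) src tgt ⊓ vanishingOn (ZMod p) S :
        Submodule (ZMod p) (E → ZMod p)))
    rw [ZMod.card] at h3
    rw [Finset.sum_boole, ← Fintype.card_subtype]
    rw [show Module.finrank ℚ (flowSpace ℚ src tgt ⊓ vanishingOn ℚ S :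
        Submodule ℚ (E → ℚ)) = Module.finrank (ZMod p)
        (flowSpace (ZMod p) src tgt ⊓ vanishingOn (ZMod p) S :
        Submodule (ZMod p) (E → ZMod p)) by omega]
    rw [← Nat.cast_pow, ← h3]
  simp_rw [← hcard, Finset.mul_sum]
  rw [Finset.sum_comm, nzFlowCount, Nat.card_eq_fintype_card, Fintype.card_subtype,
    ← Finset.sum_boole]
  refine Finset.sum_congr rfl fun f _ => ?_
  have hprod : (if ∀ e, f e ≠ 0 then (1 : ℚ) else 0) =
      ∑ S : Finset E, (-1 : ℚ) ^ S.card * if ∀ e ∈ S, f e = 0 then 1 else 0 := by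
    have h := Finset.prod_one_add (f := fun e => -if f e = 0 then (1 : ℚ) else 0) Finset.univ
    rw [Finset.powerset_univ] at h
    simp only [Finset.prod_neg, Finset.prod_ite_zero, Finset.prod_const_one] at h
    rw [← h]
    by_cases hf : ∀ e, f e ≠ 0
    · simp [hf]
    · rw [if_neg hf]
      push Not at hf
      obtain ⟨e, he⟩ := hf
      exact (Finset.prod_eq_zero (Finset.mem_univ e) (by simp [he])).symm
  have hmem : f ∈ flowSpace (ZMod p) src tgt ↔ IsFlow src tgt p f := mem_flowSpace
  simp only [Submodule.mem_inf, hmem, mem_vanishingOn]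
  by_cases hfl : IsFlow src tgt p f
  · simpa only [hfl, true_and] using hprod
  · simp [hfl]

end Flows

/-! ### Total cyclicity and positive flows -/

theorem exists_dirCycle_of_walk {V E : Type} (src tgt : E → V) (e : E)
    (h : Relation.ReflTransGen (fun u v => ∃ x, src x = u ∧ tgt x = v) (tgt e) (src e)) :
    ∃ (n : ℕ) (c : Fin (n + 1) → E), IsDirCycle src tgt n c ∧ e ∈ Set.range c := by
  have hex : ∃ n : ℕ, ∃ p : ℕ → V, p 0 = tgt e ∧ p n = src e ∧
      ∀ i < n, ∃ x, src x = p i ∧ tgt x = p (i + 1) := by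
    generalize src e = w at h
    induction h with
    | refl => exact ⟨0, fun _ => tgt e, rfl, rfl, by simp⟩
    | @tail b c _ hbc ih =>
      obtain ⟨n, p, h0, hn, hp⟩ := ih
      obtain ⟨x, hx, hx'⟩ := hbc
      refine ⟨n + 1, fun i => if i ≤ n then p i else c, by simpa using h0, by simp,
        fun i hi => ?_⟩
      rcases Nat.lt_succ_iff_lt_or_eq.1 hi with hi | rfl
      · simpa [hi.le, Nat.succ_le_of_lt hi] using hp i hi
      · exact ⟨x, by simp [hx, hn], by simp [hx']⟩
  obtain ⟨p, h0, hn, hp⟩ := Nat.find_spec hex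
  have hmin : ∀ m < Nat.find hex, _ := fun m hm => Nat.find_min hex hm
  generalize Nat.find hex = n at *
  have hinj : ∀ i j, i < j → j ≤ n → p i ≠ p j := by
    intro i j hij hj heq
    refine hmin (n - (j - i)) (by omega)
      ⟨fun k => if k ≤ i then p k else p (k + (j - i)), by simpa using h0, ?_, ?_⟩
    · dsimp only
      split_ifs with h
      · have hji : j = n := by omega
        have : n - (j - i) = i := by omega
        rw [this, heq, hji, hn]
      · rw [Nat.sub_add_cancel (by omega), hn]
    · intro k hk
      dsimp only
      rcases lt_trichotomy k i with h | rfl | h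
      · simpa [h.le, Nat.succ_le_of_lt h] using hp k (by omega)
      · have := hp j (by omega)
        simpa [heq, show k + 1 + (j - k) = j + 1 by omega] using this
      · have := hp (k + (j - i)) (by omega)
        simpa [show ¬ k ≤ i by omega, show ¬ k + 1 ≤ i by omega,
          show k + 1 + (j - i) = k + (j - i) + 1 by omega] using this
  choose x hx hx' using hp
  have hs : ∀ i : Fin (n + 1), src (if h : i.1 < n then x i.1 h else e) = p i.1 := by
    intro i
    split_ifs with h
    · exact hx _ h
    · rw [← hn]; congr 1; omega
  refine ⟨n, fun i => if h : i.1 < n then x i.1 h else e, ⟨fun i j hij => ?_, fun i => ?_⟩,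
    Fin.last n, by simp⟩
  · dsimp only at hij
    rw [hs, hs] at hij
    by_contra hne
    rcases lt_or_gt_of_ne (fun h => hne (Fin.ext h)) with h | h
    · exact hinj _ _ h (by omega) hij
    · exact hinj _ _ h (by omega) hij.symm
  · dsimp only
    rw [hs]
    split_ifs with h
    · rw [hx' _ h, Fin.val_add_one_of_lt (Fin.lt_last_iff_ne_last.2 (by rintro rfl; simp at h))]
    · have : i = Fin.last n := Fin.ext (by simp; omega)
      simp [this, h0]

section Positive

variable {V E : Type} [Fintype E]

theorem dirCycle_mem_flowSpace {src tgt : E → V} {n : ℕ} {c : Fin (n + 1) → E}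
    (hc : IsDirCycle src tgt n c) :
    (fun e => ∑ i, if c i = e then (1 : ℚ) else 0) ∈ flowSpace ℚ src tgt := by
  rw [mem_flowSpace]
  intro v
  have key : ∀ s : E → V, (∑ e, if s e = v then ∑ i, (if c i = e then (1 : ℚ) else 0) else 0) =
      ∑ i, if s (c i) = v then 1 else 0 := by
    intro s
    rw [← Finset.sum_filter, Finset.sum_comm]
    refine Finset.sum_congr rfl fun i _ => ?_
    rw [Finset.sum_ite_eq]
    simp
  rw [key, key, ← Equiv.sum_comp (Equiv.addRight (1 : Fin (n + 1)))
    (fun i => if src (c i) = v then (1 : ℚ) else 0)]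
  exact Finset.sum_congr rfl fun i _ => by rw [hc.2, Equiv.coe_addRight]

theorem totallyCyclic_iff_exists_pos_flow [Fintype V] (src tgt : E → V) :
    TotallyCyclic src tgt ↔ ∃ f ∈ flowSpace ℚ src tgt, ∀ e, 0 < f e := by
  constructor
  · intro h
    choose n c hc he using h
    refine ⟨∑ a, fun e => ∑ i, if c a i = e then (1 : ℚ) else 0,
      Submodule.sum_mem _ fun a _ => dirCycle_mem_flowSpace (hc a), fun e => ?_⟩
    rw [Finset.sum_apply]
    refine Finset.sum_pos' (fun a _ => Finset.sum_nonneg fun i _ => by split_ifs <;> simp)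
      ⟨e, Finset.mem_univ e, ?_⟩
    obtain ⟨i, hi⟩ := he e
    exact Finset.sum_pos' (fun i _ => by split_ifs <;> simp) ⟨i, Finset.mem_univ i, by simp [hi]⟩
  · rintro ⟨f, hf, hpos⟩ e
    apply exists_dirCycle_of_walk
    rw [mem_flowSpace] at hf
    set R : V → Prop := Relation.ReflTransGen (fun u v => ∃ x, src x = u ∧ tgt x = v) (tgt e)
    by_contra hne
    have hsum : ∑ x, ((if R (tgt x) then f x else 0) - if R (src x) then f x else 0) = 0 := by
      have key : ∀ s : E → V, (∑ x, if R (s x) then f x else 0) =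
          ∑ v, if R v then ∑ x, (if s x = v then f x else 0) else 0 := by
        intro s
        rw [← Finset.sum_filter (p := R), Finset.sum_comm]
        refine Finset.sum_congr rfl fun x _ => ?_
        rw [Finset.sum_ite_eq]
        simp
      rw [Finset.sum_sub_distrib, key, key, sub_eq_zero]
      simp_rw [hf]
    have hgt : 0 < ∑ x, ((if R (tgt x) then f x else 0) - if R (src x) then f x else 0) := by
      refine Finset.sum_pos' (fun x _ => ?_) ⟨e, Finset.mem_univ e, ?_⟩
      · by_cases h : R (src x)
        · have : R (tgt x) := h.tail ⟨x, rfl, rfl⟩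
          simp [h, this]
        · have := (hpos x).le
          simp only [h, if_false, sub_zero]
          split_ifs <;> simp [this]
      · have h1 : R (tgt e) := .refl
        have h2 : ¬ R (src e) := hne
        simp [h1, h2, hpos e]
    exact hgt.ne' hsum

theorem totallyCyclic_reorientation_iff [Fintype V] (src tgt : E → V) (σ : Finset E) :
    TotallyCyclic (rsrc src tgt σ) (rtgt src tgt σ) ↔
      Realises (flowSpace ℚ src tgt) Finset.univ σ := by
  have hflow : ∀ f : E → ℚ, f ∈ flowSpace ℚ (rsrc src tgt σ) (rtgt src tgt σ) ↔
      (fun e => if e ∈ σ then - f e else f e) ∈ flowSpace ℚ src tgt := by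
    intro f
    rw [mem_flowSpace, mem_flowSpace]
    refine forall_congr' fun v => ?_
    rw [← sub_eq_zero, ← Finset.sum_sub_distrib]
    conv_rhs => rw [← sub_eq_zero, ← Finset.sum_sub_distrib]
    refine Eq.congr_left (Finset.sum_congr rfl fun e _ => ?_)
    by_cases h : e ∈ σ
    · simp only [rsrc, rtgt, Finset.mem_coe, h, if_true]
      split_ifs <;> ring
    · simp [rsrc, rtgt, h]
  rw [totallyCyclic_iff_exists_pos_flow]
  constructor
  · rintro ⟨f, hf, hpos⟩
    refine ⟨_, (hflow f).1 hf, fun e _ => ?_⟩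
    have := hpos e
    split_ifs <;> linarith
  · rintro ⟨w, hw, h⟩
    refine ⟨fun e => if e ∈ σ then - w e else w e, (hflow _).2 ?_, fun e => ?_⟩
    · convert hw using 2 with e
      split_ifs <;> simp
    · have := h e (Finset.mem_univ e)
      dsimp only
      split_ifs at this ⊢ <;> linarith

end Positive

/-- For the modular flow polynomial `P = φ̄_G`, the number `(-1)^{ξ(G)} P(-1)`
is the number of totally cyclic reorientations of `G`. -/
theorem count_totally_cyclic_reorientations {V E : Type} [Fintype V] [Fintype E]
    (src tgt : E → V) (P : Polynomial ℚ)
    (hP : ∀ m : ℕ, 0 < m → P.eval (m : ℚ) = nzFlowCount src tgt m) :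
    (-1 : ℚ) ^ (xi src tgt) * P.eval (-1) =
      Nat.card {σ : Set E // TotallyCyclic (rsrc src tgt σ) (rtgt src tgt σ)} := by
  have hPeq : P = ∑ S : Finset E, Polynomial.C ((-1 : ℚ) ^ S.card) * Polynomial.X ^
      Module.finrank ℚ (flowSpace ℚ src tgt ⊓ vanishingOn ℚ S : Submodule ℚ (E → ℚ)) := by
    refine Polynomial.eq_of_infinite_eval_eq _ _ (Set.Infinite.mono ?_
      (Nat.infinite_setOfPred_prime.image (f := (Nat.cast : ℕ → ℚ)) Nat.cast_injective.injOn))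
    rintro _ ⟨p, hp, rfl⟩
    have : Fact p.Prime := ⟨hp⟩
    simp [hP p hp.pos, nzFlowCount_prime, Polynomial.eval_finsetSum]
  have hxi : xi src tgt = Module.finrank ℚ (flowSpace ℚ src tgt) := by
    have h := finrank_flowSpace_inf ℚ src tgt ∅
    have h0 : flowSpace ℚ src tgt ⊓ vanishingOn ℚ ∅ = flowSpace ℚ src tgt :=
      inf_eq_left.2 fun f _ => by simp [mem_vanishingOn]
    rw [h0, Finset.coe_empty, Set.sdiff_empty, Finset.card_empty] at h
    rw [xi, ncomp]
    omega
  have hZ := sum_realises Finset.univ (flowSpace ℚ src tgt)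
  rw [Finset.powerset_univ] at hZ
  have hcount : (Nat.card {σ : Set E // TotallyCyclic (rsrc src tgt σ) (rtgt src tgt σ)} : ℚ) =
      ∑ σ : Finset E, if Realises (flowSpace ℚ src tgt) Finset.univ σ then 1 else 0 := by
    rw [Finset.sum_boole, ← Fintype.card_subtype, ← Nat.card_eq_fintype_card]
    congr 1
    exact (Nat.card_congr (Fintype.finsetEquivSet.subtypeEquiv fun σ =>
      (totallyCyclic_reorientation_iff src tgt σ).symm)).symm
  have hsq : (-1 : ℚ) ^ Module.finrank ℚ (flowSpace ℚ src tgt) *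
      (-1) ^ Module.finrank ℚ (flowSpace ℚ src tgt) = 1 := by
    rw [← mul_pow]; norm_num
  rw [hcount, hPeq, hxi, zpow_natCast, Polynomial.eval_finsetSum]
  simp only [Polynomial.eval_mul, Polynomial.eval_C, Polynomial.eval_pow, Polynomial.eval_X]
  rw [← hZ, ← mul_assoc, hsq, one_mul]

end ModularFlows
end

section
/- Let G = (V,E) be an oriented graph with incidence matrix A_G, and let σ, σ′ ⊆ E be two totally cyclic reorientations of G. Then A_G·e_σ = A_G·e_{σ′} (where e_σ ∈ {0,1}^E is the characteristic vector of σ) if and only if the orientation _σG can be obtained from _{σ′}G by successively reversing directed cycles. -/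
namespace ModularFlows

attribute [local instance] Classical.propDecidable

variable {V E : Type}

/-- In a reoriented graph, each edge contributes to the incidence matrix with flipped sign exactly
when it is reversed. -/
lemma inc_rsrc_rtgt {V E : Type} (src tgt : E → V) (τ : Set E) (v : V) (e : E) :
    inc (rsrc src tgt τ) (rtgt src tgt τ) v e =
      if e ∈ τ then -inc src tgt v e else inc src tgt v e := by
  by_cases h : e ∈ τ <;> simp [inc, rsrc, rtgt, h]

/-- Reversing the edges of `D` changes `A_G · e_τ` by the net inflow of `D` in `_τG`. -/
lemma AeVec_symmDiff {V E : Type} [Fintype E] (src tgt : E → V) (τ D : Set E) (v : V) :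
    AeVec src tgt (symmDiff τ D) v = AeVec src tgt τ v +
      ∑ e : E, if e ∈ D then inc (rsrc src tgt τ) (rtgt src tgt τ) v e else 0 := by
  unfold AeVec
  rw [← Finset.sum_add_distrib]
  refine Finset.sum_congr rfl fun e _ => ?_
  rw [inc_rsrc_rtgt]
  by_cases h : e ∈ τ <;> by_cases h' : e ∈ D <;> simp [Set.mem_symmDiff, h, h']

/-- A directed cycle has net inflow zero at every vertex. -/
lemma IsDirCycle.sum_inc_eq_zero {V E : Type} [Fintype E] {src tgt : E → V} {n : ℕ}
    {c : Fin (n + 1) → E} (hc : IsDirCycle src tgt n c) (v : V) :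
    (∑ e : E, if e ∈ Set.range c then inc src tgt v e else 0) = 0 := by
  have hinj : Function.Injective c := fun i j h => hc.1 (congrArg src h)
  have himage : Finset.univ.filter (· ∈ Set.range c) = Finset.univ.image c := by
    ext e
    simp
  rw [← Finset.sum_filter, himage, Finset.sum_image (fun i _ j _ h => hinj h)]
  simp only [inc, hc.2]
  rw [Finset.sum_sub_distrib, sub_eq_zero]
  exact Fintype.sum_equiv (Equiv.addRight (1 : Fin (n + 1))) _ _ fun i => rfl

lemma cycleReverse.AeVec_eq {V E : Type} [Fintype E] {src tgt : E → V} {τ τ' : Set E}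
    (h : cycleReverse src tgt τ τ') : AeVec src tgt τ' = AeVec src tgt τ := by
  obtain ⟨n, c, hc, rfl⟩ := h
  funext v
  rw [AeVec_symmDiff, add_eq_left]
  convert hc.sum_inc_eq_zero v

/-- A self-map of a finite type has a periodic point in the forward orbit of every point. -/
lemma exists_iterate_mem_periodicPts {V : Type} [Finite V] (f : V → V) (x : V) :
    ∃ m, f^[m] x ∈ Function.periodicPts f := by
  obtain ⟨a, b, hab, h⟩ := Finite.exists_ne_map_eq_of_infinite fun m : ℕ => f^[m] x
  wlog hlt : a < b generalizing a b
  · exact this b a hab.symm h.symm (by omega)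
  refine ⟨a, b - a, by omega, ?_⟩
  rw [Function.IsPeriodicPt, Function.IsFixedPt, ← Function.iterate_add_apply,
    Nat.sub_add_cancel hlt.le]
  exact h.symm

/-- A nonempty edge set in which every edge is followed by another one contains a directed cycle. -/
lemma exists_isDirCycle_of_forall_exists_src_eq_tgt {V E : Type} [Finite V] {src tgt : E → V}
    {D : Set E} (hne : D.Nonempty) (hD : ∀ e ∈ D, ∃ e' ∈ D, src e' = tgt e) :
    ∃ (n : ℕ) (c : Fin (n + 1) → E), IsDirCycle src tgt n c ∧ Set.range c ⊆ D := by
  obtain ⟨e₀, he₀⟩ := hne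
  have hout : ∀ v, ∃ e', v ∈ tgt '' D → e' ∈ D ∧ src e' = v := by
    intro v
    by_cases hv : v ∈ tgt '' D
    · obtain ⟨e, he, rfl⟩ := hv
      obtain ⟨e', h⟩ := hD e he
      exact ⟨e', fun _ => h⟩
    · exact ⟨e₀, fun h => absurd h hv⟩
  choose out hout using hout
  let f : V → V := fun v => tgt (out v)
  have hmaps : Set.MapsTo f (tgt '' D) (tgt '' D) := fun v hv => ⟨out v, (hout v hv).1, rfl⟩
  obtain ⟨m, hm⟩ := exists_iterate_mem_periodicPts f (tgt e₀)
  set x := f^[m] (tgt e₀)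
  have hx : ∀ k, f^[k] x ∈ tgt '' D :=
    fun k => hmaps.iterate k (hmaps.iterate m ⟨e₀, he₀, rfl⟩)
  obtain ⟨n, hn⟩ : ∃ n, Function.minimalPeriod f x = n + 1 :=
    Nat.exists_eq_succ_of_ne_zero (Function.minimalPeriod_pos_of_mem_periodicPts hm).ne'
  refine ⟨n, fun i => out (f^[i] x), ⟨fun i j hij => ?_, fun i => ?_⟩, ?_⟩
  · simp only [(hout _ (hx _)).2] at hij
    exact Fin.ext (Function.iterate_injOn_Iio_minimalPeriod
      (i.isLt.trans_eq hn.symm) (j.isLt.trans_eq hn.symm) hij)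
  · rw [(hout _ (hx _)).2]
    change f (f^[i] x) = _
    rw [← Function.iterate_succ_apply' f, Fin.val_add, Fin.val_one', Nat.add_mod_mod,
      ← Function.iterate_mod_minimalPeriod_eq, hn]
  · rintro _ ⟨i, rfl⟩
    exact (hout _ (hx _)).1

/-- In an edge set with net inflow zero everywhere, every edge is followed by another one. -/
lemma exists_src_eq_tgt_of_sum_inc_eq_zero {V E : Type} [Fintype E] {src tgt : E → V} {D : Set E}
    (hD : ∀ v, (∑ e : E, if e ∈ D then inc src tgt v e else 0) = 0) {e : E} (he : e ∈ D) :
    ∃ e' ∈ D, src e' = tgt e := by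
  by_contra! h
  refine (hD (tgt e)).not_gt (Finset.sum_pos' (fun e' _ => ?_) ⟨e, Finset.mem_univ e, ?_⟩)
  · by_cases he' : e' ∈ D
    · simp only [inc, he', h e' he', if_true, if_false, sub_zero]
      split_ifs <;> simp
    · simp [he']
  · simp [inc, he, h e he]

/-- Equality of `A_G · e` suffices for connecting orientations by reversals of directed cycles. -/
lemma reflTransGen_cycleReverse_of_AeVec_eq {V E : Type} [Finite V] [Fintype E] (src tgt : E → V)
    {σ τ : Set E} (h : AeVec src tgt σ = AeVec src tgt τ) :
    Relation.ReflTransGen (cycleReverse src tgt) τ σ := by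
  induction hk : (symmDiff τ σ).ncard using Nat.strong_induction_on generalizing τ with
  | _ k ih =>
  rcases (symmDiff τ σ).eq_empty_or_nonempty with hempty | hne
  · rw [symmDiff_eq_bot.mp hempty]
  have hbal : ∀ v, (∑ e : E, if e ∈ symmDiff τ σ then
      inc (rsrc src tgt τ) (rtgt src tgt τ) v e else 0) = 0 := by
    intro v
    have hv := AeVec_symmDiff src tgt τ (symmDiff τ σ) v
    rw [symmDiff_symmDiff_cancel_left, h] at hv
    linarith
  obtain ⟨n, c, hc, hsub⟩ := exists_isDirCycle_of_forall_exists_src_eq_tgt hne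
    fun e he => exists_src_eq_tgt_of_sum_inc_eq_zero hbal he
  have hstep : cycleReverse src tgt τ (symmDiff τ (Set.range c)) := ⟨n, c, hc, rfl⟩
  refine .head hstep (ih _ ?_ (h.trans hstep.AeVec_eq.symm) rfl)
  have hdiff : symmDiff (symmDiff τ (Set.range c)) σ = symmDiff τ σ \ Set.range c := by
    rw [symmDiff_right_comm]
    exact symmDiff_of_ge hsub
  rw [hdiff, ← hk]
  exact Set.ncard_lt_ncard (LE.le.sdiff_ssubset_of_nonempty hsub (Set.range_nonempty c))

/-- For two totally cyclic reorientations `σ, σ'`, one has `A_G e_σ = A_G e_σ'`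
if and only if `_σG` can be obtained from `_σ'G` by successively reversing
directed cycles. -/
theorem same_fiber_iff_cycle_reversals {V E : Type} [Fintype V] [Fintype E]
    (src tgt : E → V) (σ σ' : Set E)
    (hσ : TotallyCyclic (rsrc src tgt σ) (rtgt src tgt σ))
    (hσ' : TotallyCyclic (rsrc src tgt σ') (rtgt src tgt σ')) :
    AeVec src tgt σ = AeVec src tgt σ' ↔
      Relation.ReflTransGen (cycleReverse src tgt) σ' σ := by
  refine ⟨reflTransGen_cycleReverse_of_AeVec_eq src tgt, fun h => ?_⟩
  clear hσ hσ'
  induction h with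
  | refl => rfl
  | tail _ hstep ih => exact hstep.AeVec_eq.trans ih

end ModularFlows
end

section
/- Let G = (V,E) be an oriented graph. Then t_G(0,1) = (−1)^{ξ(G)} · φ̄_G(0), and this number equals the number of distinct in-degree sequences I_{_σG}, where σ ranges over all totally cyclic reorientations of G. -/
namespace ModularFlows

attribute [local instance] Classical.propDecidable

variable {V E : Type}

/-- Identify the vertex `v` with `u`; the vertex `v` itself becomes isolated. -/
noncomputable def merge (u v : V) (x : V) : V := if x = v then u else x

lemma merge_left (u v : V) : merge u v u = u := by unfold merge; split_ifs <;> rfl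

lemma merge_right (u v : V) : merge u v v = u := by simp [merge]

lemma merge_of_ne {u v x : V} (h : x ≠ v) : merge u v x = x := by simp [merge, h]

lemma merge_ne {u v : V} (h : u ≠ v) (x : V) : merge u v x ≠ v := by
  unfold merge; split_ifs with hx
  · exact h
  · exact hx

section Components

variable (s t : E → V)

lemma ncompSub_insert_of_eq (S : Set E) (e : E)
    (h : (Quot.mk (linkRel s t S) (s e)) = Quot.mk _ (t e)) :
    ncompSub s t (insert e S) = ncompSub s t S := by
  refine Nat.card_congr ⟨Quot.lift (Quot.mk _) ?_, Quot.map id ?_, ?_, ?_⟩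
  · rintro a b ⟨f, hf, rfl, rfl⟩
    rcases hf with rfl | hf
    · exact h
    · exact Quot.sound ⟨f, hf, rfl, rfl⟩
  · rintro a b ⟨f, hf, rfl, rfl⟩
    exact ⟨f, Or.inr hf, rfl, rfl⟩
  · rintro ⟨x⟩; rfl
  · rintro ⟨x⟩; rfl

lemma ncompSub_merge [Finite V] (S : Set E) (e : E) (h : s e ≠ t e) :
    ncompSub (merge (s e) (t e) ∘ s) (merge (s e) (t e) ∘ t) S
      = ncompSub s t (insert e S) + 1 := by
  rw [ncompSub, ncompSub, ← Finite.card_option]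
  have key : ∀ x, Quot.mk (linkRel s t (insert e S)) (merge (s e) (t e) x) = Quot.mk _ x := by
    intro x
    by_cases hx : x = t e
    · subst hx
      rw [merge_right]
      exact Quot.sound ⟨e, Or.inl rfl, rfl, rfl⟩
    · rw [merge_of_ne hx]
  refine Nat.card_congr ⟨Quot.lift (fun x => if x = t e then none else some (Quot.mk _ x)) ?_,
    fun o => o.elim (Quot.mk _ (t e)) (Quot.lift (fun x => Quot.mk _ (merge (s e) (t e) x)) ?_),
    ?_, ?_⟩
  · rintro a b ⟨f, hf, rfl, rfl⟩
    simp only [Function.comp, merge_ne h, if_false, key]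
    exact congrArg some (Quot.sound ⟨f, Or.inr hf, rfl, rfl⟩)
  · rintro a b ⟨f, hf, rfl, rfl⟩
    rcases hf with rfl | hf
    · rw [merge_left, merge_right]
    · exact Quot.sound ⟨f, hf, rfl, rfl⟩
  · rintro ⟨x⟩
    by_cases hx : x = t e
    · simp [hx]
    · simp [hx, merge_of_ne hx]
  · rintro (_ | ⟨⟨x⟩⟩)
    · simp
    · simp [merge_ne h, key]

/-- The connected components of `(V, S ∪ {e})` when `e` joins two components of `(V, S)`. -/
lemma ncompSub_insert_of_ne [Finite V] (S : Set E) (e : E)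
    (h : (Quot.mk (linkRel s t S) (s e)) ≠ Quot.mk _ (t e)) :
    ncompSub s t S = ncompSub s t (insert e S) + 1 := by
  rw [ncompSub, ncompSub, ← Finite.card_option]
  have key : ∀ x : V, Quot.mk (linkRel s t S) x = Quot.mk _ (t e) →
      Quot.mk (linkRel s t (insert e S)) x = Quot.mk _ (t e) := by
    intro x hx
    have := congrArg (Quot.map id (fun a b (hab : linkRel s t S a b) =>
      (show linkRel s t (insert e S) a b from
        let ⟨f, hf, h1, h2⟩ := hab; ⟨f, Or.inr hf, h1, h2⟩))) hx
    exact this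
  refine Nat.card_congr ⟨fun q => if q = Quot.mk _ (t e) then none else some (Quot.map id ?_ q),
    fun o => o.elim (Quot.mk _ (t e)) (Quot.lift (fun x =>
      if Quot.mk (linkRel s t S) x = Quot.mk _ (t e) then Quot.mk _ (s e) else Quot.mk _ x) ?_),
    ?_, ?_⟩
  · rintro a b ⟨f, hf, rfl, rfl⟩
    exact ⟨f, Or.inr hf, rfl, rfl⟩
  · rintro a b ⟨f, hf, rfl, rfl⟩
    rcases hf with rfl | hf
    · simp [h]
    · have : Quot.mk (linkRel s t S) (s f) = Quot.mk _ (t f) := Quot.sound ⟨f, hf, rfl, rfl⟩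
      simp only [this]
  · rintro ⟨x⟩
    by_cases hx : Quot.mk (linkRel s t S) x = Quot.mk _ (t e)
    · simp [hx]
    · simp [hx, Quot.map]
  · rintro (_ | ⟨⟨x⟩⟩)
    · simp
    · by_cases hx : Quot.mk (linkRel s t S) x = Quot.mk _ (t e)
      · have h1 : Quot.mk (linkRel s t (insert e S)) (s e) = Quot.mk _ (t e) :=
          Quot.sound ⟨e, Or.inl rfl, rfl, rfl⟩
        simp [h, Quot.map, key x hx, h1]
      · simp [hx, Quot.map]

lemma ncompSub_empty_s5 [Fintype V] : ncompSub s t ∅ = Fintype.card V := by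
  rw [ncompSub, ← Nat.card_eq_fintype_card]
  refine Nat.card_congr ⟨Quot.lift id ?_, Quot.mk _, ?_, ?_⟩
  · rintro a b ⟨f, hf, -⟩
    exact hf.elim
  · rintro ⟨x⟩; rfl
  · intro x; rfl

lemma ncompSub_le_card [Fintype V] (S : Set E) : ncompSub s t S ≤ Fintype.card V := by
  rw [ncompSub, ← Nat.card_eq_fintype_card]
  exact Nat.card_le_card_of_surjective _ Quot.mk_surjective

lemma card_le_ncompSub_add_card [Fintype V] (S : Finset E) :
    Fintype.card V ≤ ncompSub s t ↑S + S.card := by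
  induction S using Finset.induction_on with
  | empty => simp [ncompSub_empty_s5]
  | insert e S he ih =>
    rw [Finset.coe_insert, Finset.card_insert_of_notMem he]
    by_cases h : Quot.mk (linkRel s t ↑S) (s e) = Quot.mk _ (t e)
    · rw [ncompSub_insert_of_eq s t _ _ h]; omega
    · have := ncompSub_insert_of_ne s t _ _ h; omega

lemma ncompSub_anti [Finite V] {S T : Set E} (h : S ⊆ T) : ncompSub s t T ≤ ncompSub s t S := by
  refine Nat.card_le_card_of_surjective (Quot.map id ?_) ?_
  · rintro a b ⟨f, hf, rfl, rfl⟩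
    exact ⟨f, h hf, rfl, rfl⟩
  · rintro ⟨x⟩
    exact ⟨Quot.mk _ x, rfl⟩

end Components

section Forests

variable [Fintype V] (s t : E → V)

/-- `S` is the edge set of a spanning forest. -/
def IsForest (S : Finset E) : Prop := ncompSub s t ↑S + S.card = Fintype.card V

/-- The alternating count of forests contained in `A`. -/
noncomputable def forestSum (A : Finset E) : ℤ :=
  ∑ S ∈ A.powerset, if IsForest s t S then (-1) ^ S.card else 0

lemma forestSum_empty : forestSum s t ∅ = 1 := by
  simp [forestSum, IsForest, ncompSub_empty_s5]

lemma forestSum_insert_of_loop {A : Finset E} {e : E} (he : e ∉ A) (h : s e = t e) :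
    forestSum s t (insert e A) = forestSum s t A := by
  rw [forestSum, Finset.sum_powerset_insert he, forestSum, add_eq_left]
  refine Finset.sum_eq_zero fun S hS => if_neg fun hF => ?_
  have heS : e ∉ S := fun h' => he (Finset.mem_powerset.1 hS h')
  have h1 := card_le_ncompSub_add_card s t S
  rw [IsForest, Finset.coe_insert, ncompSub_insert_of_eq s t _ _ (by rw [h]),
    Finset.card_insert_of_notMem heS] at hF
  omega

lemma forestSum_insert {A : Finset E} {e : E} (he : e ∉ A) (h : s e ≠ t e) :
    forestSum s t (insert e A) = forestSum s t A
      - forestSum (merge (s e) (t e) ∘ s) (merge (s e) (t e) ∘ t) A := by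
  rw [forestSum, Finset.sum_powerset_insert he, forestSum, forestSum, sub_eq_add_neg,
    ← Finset.sum_neg_distrib]
  congr 1
  refine Finset.sum_congr rfl fun S hS => ?_
  have heS : e ∉ S := fun h' => he (Finset.mem_powerset.1 hS h')
  have : IsForest s t (insert e S) ↔
      IsForest (merge (s e) (t e) ∘ s) (merge (s e) (t e) ∘ t) S := by
    rw [IsForest, IsForest, ncompSub_merge s t _ _ h, Finset.coe_insert,
      Finset.card_insert_of_notMem heS]
    omega
  simp only [this, Finset.card_insert_of_notMem heS, pow_succ]
  split_ifs <;> simp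

lemma forestSum_insert_of_bridge {A : Finset E} {e : E} (he : e ∉ A)
    (h : Quot.mk (linkRel s t ↑A) (s e) ≠ Quot.mk _ (t e)) :
    forestSum s t (insert e A) = 0 := by
  have hne : s e ≠ t e := fun h' => h (by rw [h'])
  rw [forestSum_insert s t he hne, sub_eq_zero]
  refine Finset.sum_congr rfl fun S hS => ?_
  have hS' : Quot.mk (linkRel s t ↑S) (s e) ≠ Quot.mk _ (t e) := by
    intro h'
    refine h (congrArg (Quot.map id ?_) h')
    rintro a b ⟨f, hf, rfl, rfl⟩
    exact ⟨f, Finset.mem_powerset.1 hS hf, rfl, rfl⟩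
  have : IsForest (merge (s e) (t e) ∘ s) (merge (s e) (t e) ∘ t) S ↔ IsForest s t S := by
    rw [IsForest, IsForest, ncompSub_merge s t _ _ hne, ncompSub_insert_of_ne s t _ _ hS']
  simp only [this]

/-- The evaluation `t_G(0,1)` as a signed count of forests. -/
lemma tutte_zero_one_eq_forestSum [Fintype E] :
    tutte s t 0 1 = (-1) ^ (Fintype.card V + ncomp s t) * (forestSum s t Finset.univ : ℚ) := by
  rw [tutte, forestSum, Finset.powerset_univ]
  push_cast
  rw [Finset.mul_sum]
  refine Finset.sum_congr rfl fun S _ => ?_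
  have h1 := ncompSub_le_card s t (Set.univ : Set E)
  have h2 := ncompSub_le_card s t (↑S : Set E)
  have h3 := card_le_ncompSub_add_card s t S
  have h4 := ncompSub_anti s t (Set.subset_univ (↑S : Set E))
  rw [rk, rk, sub_self, zero_sub]
  by_cases hF : IsForest s t S
  · rw [if_pos hF]
    rw [IsForest] at hF
    rw [show S.card - (Fintype.card V - ncompSub s t ↑S) = 0 by omega, pow_zero, mul_one,
      ← pow_add]
    refine neg_one_pow_congr ?_
    rw [ncomp]
    simp only [Nat.even_iff]
    omega
  · rw [if_neg hF]
    rw [IsForest] at hF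
    rw [zero_pow (by omega), mul_zero, mul_zero]

end Forests

section Flows

variable [Fintype E] (s t : E → V) (k : ℕ)

lemma isFlow_iff_potential [Fintype V] (f : E → ZMod k) :
    IsFlow s t k f ↔ ∀ p : V → ZMod k, ∑ e, f e * (p (t e) - p (s e)) = 0 := by
  constructor
  · intro h p
    have aux : ∀ r : E → V, ∑ e, f e * p (r e) = ∑ v, p v * ∑ e, if r e = v then f e else 0 := by
      intro r
      simp only [Finset.mul_sum]
      rw [Finset.sum_comm]
      refine Finset.sum_congr rfl fun e _ => ?_
      simp [mul_comm]
    simp only [mul_sub, Finset.sum_sub_distrib, aux]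
    rw [sub_eq_zero]
    exact Finset.sum_congr rfl fun v _ => by rw [h v]
  · intro h v
    have := h (Pi.single v 1)
    simp only [mul_sub, Finset.sum_sub_distrib, sub_eq_zero, Pi.single_apply, mul_ite, mul_one,
      mul_zero] at this
    exact this

lemma sum_update_mul (f : E → ZMod k) (e : E) (x : ZMod k) (g : E → ZMod k) :
    ∑ e', Function.update f e x e' * g e' = ∑ e', f e' * g e' + (x - f e) * g e := by
  have : ∀ e', Function.update f e x e' * g e'
      = f e' * g e' + if e' = e then (x - f e) * g e else 0 := by
    intro e'
    by_cases h : e' = e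
    · subst h; simp; ring
    · simp [h]
  simp [this, Finset.sum_add_distrib]

/-- The `ZMod k`-flows whose support is exactly `A`. -/
def flowsOn (A : Finset E) : Set (E → ZMod k) := {f | IsFlow s t k f ∧ ∀ e, f e ≠ 0 ↔ e ∈ A}

lemma ncard_flowsOn_univ : (flowsOn s t k Finset.univ).ncard = nzFlowCount s t k := by
  rw [nzFlowCount, ← Nat.card_coe_set_eq]
  simp only [flowsOn, Finset.mem_univ, iff_true]
  rfl

lemma flowsOn_empty : flowsOn s t k ∅ = {0} := by
  ext f
  simp only [flowsOn, Set.mem_ofPred_eq, Set.mem_singleton_iff, Finset.notMem_empty, iff_false,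
    not_not]
  constructor
  · rintro ⟨-, h⟩; exact funext h
  · rintro rfl; exact ⟨fun v => by simp, fun _ => rfl⟩

variable [Fintype V] [NeZero k]

lemma ncard_flowsOn_insert_of_loop {A : Finset E} {e : E} (he : e ∉ A) (h : s e = t e) :
    (flowsOn s t k (insert e A)).ncard = (k - 1) * (flowsOn s t k A).ncard := by
  have hflow : ∀ (f : E → ZMod k) x, IsFlow s t k (Function.update f e x) ↔ IsFlow s t k f := by
    intro f x
    simp only [isFlow_iff_potential, sum_update_mul, h, sub_self, mul_zero, add_zero]
  have himg : flowsOn s t k (insert e A) =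
      (fun q : ZMod k × (E → ZMod k) => Function.update q.2 e q.1) ''
        ({0}ᶜ ×ˢ flowsOn s t k A) := by
    ext f
    constructor
    · rintro ⟨hf, hA⟩
      refine ⟨(f e, Function.update f e 0), ⟨?_, (hflow _ _).2 hf, ?_⟩, by simp⟩
      · exact (hA e).2 (Finset.mem_insert_self _ _)
      · intro e'
        by_cases h' : e' = e
        · subst h'; simpa using he
        · simp [h', hA]
    · rintro ⟨⟨x, g⟩, ⟨hx, hg, hA⟩, rfl⟩
      refine ⟨(hflow _ _).2 hg, fun e' => ?_⟩
      by_cases h' : e' = e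
      · subst h'; simpa using hx
      · simp [h', hA]
  rw [himg, Set.InjOn.ncard_image, Set.ncard_prod, Set.ncard_compl, Set.ncard_singleton,
    Nat.card_zmod]
  rintro ⟨x, f⟩ ⟨-, -, hf⟩ ⟨y, g⟩ ⟨-, -, hg⟩ hfg
  have hfe : f e = 0 := not_not.1 (mt (hf e).1 he)
  have hge : g e = 0 := not_not.1 (mt (hg e).1 he)
  simp only at hfg
  refine Prod.ext (by simpa using congrFun hfg e) (funext fun e' => ?_)
  by_cases h' : e' = e
  · subst h'; exact hfe.trans hge.symm
  · simpa [h'] using congrFun hfg e'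

lemma ncard_flowsOn_merge {A : Finset E} {e : E} (he : e ∉ A) (h : s e ≠ t e) :
    (flowsOn (merge (s e) (t e) ∘ s) (merge (s e) (t e) ∘ t) k A).ncard =
      (flowsOn s t k (insert e A)).ncard + (flowsOn s t k A).ncard := by
  have hdisj : Disjoint (flowsOn s t k (insert e A)) (flowsOn s t k A) := by
    rw [Set.disjoint_left]
    rintro f ⟨-, h1⟩ ⟨-, h2⟩
    exact he ((h2 e).1 ((h1 e).2 (Finset.mem_insert_self _ _)))
  rw [← Set.ncard_union_eq hdisj]
  have hoff : ∀ f ∈ flowsOn s t k (insert e A) ∪ flowsOn s t k A, IsFlow s t k f ∧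
      ∀ e', e' ≠ e → (f e' ≠ 0 ↔ e' ∈ A) := by
    rintro f (⟨hf, hA⟩ | ⟨hf, hA⟩)
    · exact ⟨hf, fun e' h' => by simp [hA, h']⟩
    · exact ⟨hf, fun e' h' => hA e'⟩
  have himg : flowsOn (merge (s e) (t e) ∘ s) (merge (s e) (t e) ∘ t) k A =
      (fun f => Function.update f e 0) '' (flowsOn s t k (insert e A) ∪ flowsOn s t k A) := by
    ext g
    constructor
    · rintro ⟨hg, hA⟩
      have hge : g e = 0 := not_not.1 (mt (hA e).1 he)
      rw [isFlow_iff_potential] at hg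
      set δ : V → ZMod k := Pi.single (t e) 1 with hδ
      have hδt : δ (t e) = 1 := by simp [hδ]
      have hδs : δ (s e) = 0 := by simp [hδ, h]
      set x : ZMod k := - ∑ e', g e' * (δ (t e') - δ (s e')) with hx
      have hflow : IsFlow s t k (Function.update g e x) := by
        rw [isFlow_iff_potential]
        intro p
        have hp : ∀ w, p w = p (merge (s e) (t e) w) + (p (t e) - p (s e)) * δ w := by
          intro w
          by_cases hw : w = t e
          · subst hw; rw [merge_right, hδt]; ring
          · rw [merge_of_ne hw]; simp [hδ, hw]
        have hsum : ∑ e', g e' * (p (t e') - p (s e')) =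
            ∑ e', g e' * (p (merge (s e) (t e) (t e')) - p (merge (s e) (t e) (s e')))
              + (p (t e) - p (s e)) * ∑ e', g e' * (δ (t e') - δ (s e')) := by
          rw [Finset.mul_sum, ← Finset.sum_add_distrib]
          refine Finset.sum_congr rfl fun e' _ => ?_
          rw [hp (t e'), hp (s e')]
          ring
        have hgp := hg p
        simp only [Function.comp] at hgp
        rw [sum_update_mul, hsum, hgp, hge, hx]
        ring
      have hsupp : ∀ e', e' ≠ e → (Function.update g e x e' ≠ 0 ↔ e' ∈ A) := by
        intro e' h'
        simp [h', hA]
      refine ⟨Function.update g e x, ?_, by simp [← hge]⟩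
      by_cases hx0 : x = 0
      · right
        refine ⟨hflow, fun e' => ?_⟩
        by_cases h' : e' = e
        · subst h'; simpa [hx0] using he
        · exact hsupp e' h'
      · left
        refine ⟨hflow, fun e' => ?_⟩
        by_cases h' : e' = e
        · subst h'; simpa using hx0
        · rw [hsupp e' h']; simp [h']
    · rintro ⟨f, hf, rfl⟩
      obtain ⟨hf, hA⟩ := hoff f hf
      refine ⟨?_, fun e' => ?_⟩
      · rw [isFlow_iff_potential] at hf ⊢
        intro p
        have := hf (p ∘ merge (s e) (t e))
        simp only [Function.comp] at this
        rw [sum_update_mul]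
        simp [this, merge_left, merge_right]
      · by_cases h' : e' = e
        · subst h'; simpa using he
        · simp [h', hA]
  rw [himg, Set.InjOn.ncard_image]
  intro f hf g hg hfg
  simp only at hfg
  have hoffe : ∀ e', e' ≠ e → f e' = g e' := fun e' h' => by simpa [h'] using congrFun hfg e'
  have hg' : g = Function.update f e (g e) := by
    funext e'
    by_cases h' : e' = e
    · subst h'; simp
    · simp [h', hoffe e' h']
  have h1 := (isFlow_iff_potential s t k f).1 (hoff f hf).1 (Pi.single (t e) 1)
  have h2 := (isFlow_iff_potential s t k g).1 (hoff g hg).1 (Pi.single (t e) 1)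
  rw [hg', sum_update_mul, h1] at h2
  simp only [Pi.single_eq_same, Pi.single_eq_of_ne h] at h2
  have hfe : g e = f e := by linear_combination h2
  rw [hg', hfe, Function.update_eq_self]

/-- The flow polynomial exists, and its constant term is a signed count of forests. -/
lemma exists_flowPolynomial (A : Finset E) : ∀ s t : E → V, ∃ P : Polynomial ℚ,
    (∀ m : ℕ, 0 < m → P.eval (m : ℚ) = (flowsOn s t m A).ncard) ∧
    P.eval 0 = (-1) ^ A.card * (forestSum s t A : ℚ) := by
  induction A using Finset.induction_on with
  | empty =>
    intro s t
    exact ⟨1, fun m _ => by simp [flowsOn_empty], by simp [forestSum_empty]⟩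
  | insert e A he ih =>
    intro s t
    obtain ⟨P, hP, hP0⟩ := ih s t
    by_cases h : s e = t e
    · refine ⟨(Polynomial.X - 1) * P, fun m hm => ?_, ?_⟩
      · have : NeZero m := ⟨hm.ne'⟩
        rw [ncard_flowsOn_insert_of_loop s t m he h]
        simp [hP m hm, Nat.cast_sub (Nat.one_le_iff_ne_zero.2 hm.ne')]
      · simp [hP0, forestSum_insert_of_loop s t he h, Finset.card_insert_of_notMem he, pow_succ]
    · obtain ⟨Q, hQ, hQ0⟩ := ih (merge (s e) (t e) ∘ s) (merge (s e) (t e) ∘ t)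
      refine ⟨Q - P, fun m hm => ?_, ?_⟩
      · have : NeZero m := ⟨hm.ne'⟩
        rw [Polynomial.eval_sub, hP m hm, hQ m hm, ncard_flowsOn_merge s t m he h]
        simp
      · rw [Polynomial.eval_sub, hP0, hQ0, forestSum_insert s t he h,
          Finset.card_insert_of_notMem he, pow_succ]
        push_cast
        ring

lemma eval_zero_flowPolynomial (P : Polynomial ℚ)
    (hP : ∀ m : ℕ, 0 < m → P.eval (m : ℚ) = nzFlowCount s t m) :
    P.eval 0 = (-1) ^ Fintype.card E * (forestSum s t Finset.univ : ℚ) := by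
  obtain ⟨Q, hQ, hQ0⟩ := exists_flowPolynomial Finset.univ s t
  have : P = Q := by
    refine Polynomial.eq_of_infinite_eval_eq P Q (Set.Infinite.mono ?_
      ((Set.Ioi_infinite (0 : ℕ)).image (Nat.cast_injective (R := ℚ)).injOn))
    rintro _ ⟨m, hm, rfl⟩
    simp only [Set.mem_ofPred_eq]
    rw [hP m hm, hQ m hm, ncard_flowsOn_univ]
  rw [this, hQ0, Finset.card_univ]

end Flows

section Lattice

variable (s t : E → V)

/-- The edges of `A` with both ends in `X`. -/
noncomputable def edgesIn (A : Finset E) (X : Finset V) : Finset E :=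
  A.filter fun e => s e ∈ X ∧ t e ∈ X

/-- Some edge of `A` joins `X` to its complement. -/
def HasBoundary (A : Finset E) (X : Finset V) : Prop := ∃ e ∈ A, ¬ (s e ∈ X ↔ t e ∈ X)

/-- The number of edges of `A` inside `X`, plus one if some edge of `A` joins `X` to its
complement. -/
noncomputable def demand (A : Finset E) (X : Finset V) : ℤ :=
  (edgesIn s t A X).card + if HasBoundary s t A X then 1 else 0

/-- The integer vectors satisfying the inequalities that characterize the in-degree sequences of
totally cyclic reorientations of the graph with edge set `A`. -/
def indegLattice [Fintype V] (A : Finset E) : Set (V → ℤ) :=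
  {d | ∑ v, d v = A.card ∧ ∀ X : Finset V, demand s t A X ≤ ∑ v ∈ X, d v}

lemma card_edgesIn_insert {A : Finset E} {e : E} (he : e ∉ A) (X : Finset V) :
    (edgesIn s t (insert e A) X).card
      = (edgesIn s t A X).card + if s e ∈ X ∧ t e ∈ X then 1 else 0 := by
  unfold edgesIn
  rw [Finset.filter_insert]
  split_ifs with h
  · rw [Finset.card_insert_of_notMem (by simp [he])]
  · rfl

lemma hasBoundary_insert (A : Finset E) (e : E) (X : Finset V) :
    HasBoundary s t (insert e A) X ↔ ¬ (s e ∈ X ↔ t e ∈ X) ∨ HasBoundary s t A X := by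
  simp [HasBoundary]

lemma demand_insert_of_mem {A : Finset E} {e : E} (he : e ∉ A) {X : Finset V}
    (hs : s e ∈ X) (ht : t e ∈ X) : demand s t (insert e A) X = demand s t A X + 1 := by
  simp only [demand, card_edgesIn_insert s t he, hasBoundary_insert, hs, ht]
  simp
  ring

lemma demand_insert_of_notMem {A : Finset E} {e : E} (he : e ∉ A) {X : Finset V}
    (hs : s e ∉ X) (ht : t e ∉ X) : demand s t (insert e A) X = demand s t A X := by
  simp only [demand, card_edgesIn_insert s t he, hasBoundary_insert, hs, ht]
  simp

lemma demand_insert_of_sep {A : Finset E} {e : E} (he : e ∉ A) {X : Finset V}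
    (h : ¬ (s e ∈ X ↔ t e ∈ X)) :
    demand s t (insert e A) X = (edgesIn s t A X).card + 1 := by
  have h' : ¬ (s e ∈ X ∧ t e ∈ X) := fun h' => h ⟨fun _ => h'.2, fun _ => h'.1⟩
  simp only [demand, card_edgesIn_insert s t he, hasBoundary_insert, h, h']
  simp

lemma hasBoundary_of_sep {A : Finset E} {x y : V}
    (h : Quot.mk (linkRel s t ↑A) x = Quot.mk _ y) {X : Finset V} (hX : ¬ (x ∈ X ↔ y ∈ X)) :
    HasBoundary s t A X := by
  by_contra hb
  refine hX (iff_of_eq (congrArg (Quot.lift (fun z => z ∈ X) ?_) h))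
  rintro a b ⟨f, hf, rfl, rfl⟩
  by_contra hne
  exact hb ⟨f, hf, fun h' => hne (propext h')⟩

lemma demand_of_sep {A : Finset E} {x y : V}
    (h : Quot.mk (linkRel s t ↑A) x = Quot.mk _ y) {X : Finset V} (hX : ¬ (x ∈ X ↔ y ∈ X)) :
    demand s t A X = (edgesIn s t A X).card + 1 := by
  rw [demand, if_pos (hasBoundary_of_sep s t h hX)]

/-- Strict supermodularity of `edgesIn` on two sets, one of which has a boundary. -/
lemma card_edgesIn_add_le (A : Finset E) (X Y : Finset V) (hX : HasBoundary s t A X) :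
    ((edgesIn s t A X).card : ℤ) + (edgesIn s t A Y).card + 1
      ≤ demand s t A (X ∪ Y) + demand s t A (X ∩ Y) := by
  have hinter : edgesIn s t A X ∩ edgesIn s t A Y = edgesIn s t A (X ∩ Y) := by
    ext f; simp only [edgesIn, Finset.mem_inter, Finset.mem_filter]; tauto
  have hunion : edgesIn s t A X ∪ edgesIn s t A Y ⊆ edgesIn s t A (X ∪ Y) := by
    intro f; simp only [edgesIn, Finset.mem_union, Finset.mem_filter]; tauto
  have hcard := Finset.card_union_add_card_inter (edgesIn s t A X) (edgesIn s t A Y)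
  rw [hinter] at hcard
  unfold demand
  by_cases hb : HasBoundary s t A (X ∪ Y) ∨ HasBoundary s t A (X ∩ Y)
  · have := Finset.card_le_card hunion
    rcases hb with hb | hb
    · rw [if_pos hb]; split_ifs <;> omega
    · rw [if_pos hb]; split_ifs <;> omega
  · obtain ⟨hb1, hb2⟩ := not_or.1 hb
    obtain ⟨f, hf, hfX⟩ := hX
    have h1 : s f ∈ X ∪ Y ↔ t f ∈ X ∪ Y := by
      by_contra h; exact hb1 ⟨f, hf, h⟩
    have h2 : s f ∈ X ∩ Y ↔ t f ∈ X ∩ Y := by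
      by_contra h; exact hb2 ⟨f, hf, h⟩
    have hnot : f ∉ edgesIn s t A X ∪ edgesIn s t A Y := by
      simp only [Finset.mem_union, Finset.mem_inter] at h1 h2
      simp only [edgesIn, Finset.mem_union, Finset.mem_filter]; tauto
    have hmem : f ∈ edgesIn s t A (X ∪ Y) := by
      simp only [Finset.mem_union, Finset.mem_inter] at h1 h2
      simp only [edgesIn, Finset.mem_union, Finset.mem_filter]; tauto
    have := Finset.card_le_card (Finset.insert_subset hmem hunion)
    rw [Finset.card_insert_of_notMem hnot] at this
    rw [if_neg hb1, if_neg hb2]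
    omega

lemma sum_add_single (d : V → ℤ) (v : V) (X : Finset V) :
    ∑ x ∈ X, (d + Pi.single v 1 : V → ℤ) x = ∑ x ∈ X, d x + if v ∈ X then 1 else 0 := by
  simp [Finset.sum_add_distrib, Pi.single_apply]

variable [Fintype V]

lemma indegLattice_nonneg {A : Finset E} {d : V → ℤ} (hd : d ∈ indegLattice s t A) (v : V) :
    0 ≤ d v := by
  have := hd.2 {v}
  rw [Finset.sum_singleton] at this
  refine le_trans ?_ this
  unfold demand
  split_ifs <;> positivity

lemma finite_indegLattice (A : Finset E) : (indegLattice s t A).Finite := by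
  refine Set.Finite.subset (Set.finite_Icc (0 : V → ℤ) fun _ => A.card) fun d hd => ⟨?_, ?_⟩
  · exact indegLattice_nonneg s t hd
  · intro v
    show d v ≤ _
    rw [← hd.1]
    exact Finset.single_le_sum (fun w _ => indegLattice_nonneg s t hd w) (Finset.mem_univ v)

lemma indegLattice_empty : indegLattice s t ∅ = {0} := by
  ext d
  constructor
  · intro hd
    funext v
    refine le_antisymm ?_ (indegLattice_nonneg s t hd v)
    have := Finset.single_le_sum (fun w _ => indegLattice_nonneg s t hd w) (Finset.mem_univ v)
    rwa [hd.1] at this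
  · rintro rfl
    exact ⟨by simp, fun X => by simp [demand, edgesIn, HasBoundary]⟩

lemma ncard_indegLattice_insert_of_loop {A : Finset E} {e : E} (he : e ∉ A) (h : s e = t e) :
    (indegLattice s t (insert e A)).ncard = (indegLattice s t A).ncard := by
  have hmem : ∀ d : V → ℤ, d + Pi.single (s e) 1 ∈ indegLattice s t (insert e A) ↔
      d ∈ indegLattice s t A := by
    intro d
    simp only [indegLattice, Set.mem_ofPred_eq, sum_add_single, Finset.mem_univ, if_true,
      Finset.card_insert_of_notMem he, Nat.cast_add, Nat.cast_one, add_left_inj]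
    refine and_congr_right fun _ => forall_congr' fun X => ?_
    by_cases hX : s e ∈ X
    · rw [demand_insert_of_mem s t he hX (h ▸ hX), if_pos hX, add_le_add_iff_right]
    · rw [demand_insert_of_notMem s t he hX (h ▸ hX), if_neg hX, add_zero]
  have himg : indegLattice s t (insert e A) =
      (fun d : V → ℤ => d + Pi.single (s e) 1) '' indegLattice s t A := by
    ext d
    constructor
    · intro hd
      refine ⟨d - Pi.single (s e) 1, (hmem _).1 ?_, ?_⟩ <;> simp [hd]
    · rintro ⟨d, hd, rfl⟩
      exact (hmem d).2 hd
  rw [himg, Set.InjOn.ncard_image (add_left_injective _).injOn]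

lemma indegLattice_insert_of_bridge {A : Finset E} {e : E} (he : e ∉ A)
    (h : Quot.mk (linkRel s t ↑A) (s e) ≠ Quot.mk _ (t e)) :
    indegLattice s t (insert e A) = ∅ := by
  refine Set.eq_empty_of_forall_notMem fun d hd => ?_
  set X : Finset V := Finset.univ.filter fun x =>
    Quot.mk (linkRel s t ↑A) x = Quot.mk _ (s e) with hXdef
  have hs : s e ∈ X := by simp [hXdef]
  have ht : t e ∉ X := by simp [hXdef, h.symm]
  have hA : ∀ f ∈ A, (s f ∈ X ↔ t f ∈ X) := by
    intro f hf
    have : Quot.mk (linkRel s t ↑A) (s f) = Quot.mk _ (t f) := Quot.sound ⟨f, hf, rfl, rfl⟩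
    simp [hXdef, this]
  have h1 := hd.2 X
  have h2 := hd.2 Xᶜ
  have h3 := hd.1
  rw [← Finset.sum_add_sum_compl X, Finset.card_insert_of_notMem he] at h3
  rw [demand_insert_of_sep s t he (by tauto)] at h1
  rw [demand_insert_of_sep s t he (by simp only [Finset.mem_compl]; tauto)] at h2
  have h4 : (edgesIn s t A X).card + (edgesIn s t A Xᶜ).card = A.card := by
    rw [← Finset.card_filter_add_card_filter_not (s := A) fun f => s f ∈ X ∧ t f ∈ X]
    congr 2
    refine Finset.filter_congr fun f hf => ?_
    have := hA f hf
    simp only [Finset.mem_compl]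
    tauto
  push_cast at h3
  omega

/-- The vector obtained from `d` by moving the value at `v` to `u` and lowering it by one. -/
noncomputable def contractVec (u v : V) (d : V → ℤ) (w : V) : ℤ :=
  (∑ x, if merge u v x = w then d x else 0) - if w = u then 1 else 0

lemma contractVec_left {u v : V} (h : u ≠ v) (d : V → ℤ) :
    contractVec u v d u = d u + d v - 1 := by
  have : ∀ x, (if merge u v x = u then d x else 0)
      = (if x = u then d x else 0) + if x = v then d x else 0 := by
    intro x
    by_cases hx : x = v
    · subst hx; simp [merge_right, h.symm]
    · simp [merge_of_ne hx, hx]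
  simp [contractVec, this, Finset.sum_add_distrib]

lemma contractVec_right {u v : V} (h : u ≠ v) (d : V → ℤ) : contractVec u v d v = 0 := by
  simp [contractVec, merge_ne h, h.symm]

lemma contractVec_of_ne {u v w : V} (hu : w ≠ u) (hv : w ≠ v) (d : V → ℤ) :
    contractVec u v d w = d w := by
  have : ∀ x, (if merge u v x = w then d x else 0) = if x = w then d x else 0 := by
    intro x
    by_cases hx : x = v
    · subst hx; simp [merge_right, hu.symm, hv.symm]
    · simp [merge_of_ne hx]
  simp [contractVec, this, hu]

lemma sum_contractVec (u v : V) (d : V → ℤ) (X : Finset V) :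
    ∑ w ∈ X, contractVec u v d w
      = ∑ x ∈ Finset.univ.filter (fun x => merge u v x ∈ X), d x - if u ∈ X then 1 else 0 := by
  simp only [contractVec, Finset.sum_sub_distrib]
  rw [Finset.sum_comm, Finset.sum_filter]
  simp

lemma demand_merge (A : Finset E) (u v : V) (X : Finset V) :
    demand (merge u v ∘ s) (merge u v ∘ t) A X
      = demand s t A (Finset.univ.filter fun x => merge u v x ∈ X) := by
  have h : HasBoundary (merge u v ∘ s) (merge u v ∘ t) A X
      ↔ HasBoundary s t A (Finset.univ.filter fun x => merge u v x ∈ X) := by simp [HasBoundary]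
  simp only [demand, h]
  simp [edgesIn]

lemma filter_merge_mem_eq_self {u v : V} {X : Finset V} (h : u ∈ X ↔ v ∈ X) :
    (Finset.univ.filter fun x => merge u v x ∈ X) = X := by
  ext x
  by_cases hx : x = v
  · subst hx; simp [merge_right, h]
  · simp [merge_of_ne hx]

/-- The inequalities for the sets that do not separate the ends of `e`. -/
def Unseparated (A : Finset E) (e : E) (d : V → ℤ) : Prop :=
  ∑ v, d v = A.card + 1 ∧
    (∀ X : Finset V, s e ∈ X → t e ∈ X → demand s t A X + 1 ≤ ∑ v ∈ X, d v) ∧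
    ∀ X : Finset V, s e ∉ X → t e ∉ X → demand s t A X ≤ ∑ v ∈ X, d v

/-- The inequalities, with slack `j`, for the sets containing `x` but not `y`. -/
def Separated (A : Finset E) (x y : V) (j : ℤ) (d : V → ℤ) : Prop :=
  ∀ X : Finset V, x ∈ X → y ∉ X → ((edgesIn s t A X).card : ℤ) + j ≤ ∑ v ∈ X, d v

lemma contractVec_mem_iff (A : Finset E) {e : E} (d : V → ℤ) :
    contractVec (s e) (t e) d ∈ indegLattice (merge (s e) (t e) ∘ s) (merge (s e) (t e) ∘ t) A ↔
      Unseparated s t A e d := by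
  simp only [indegLattice, Set.mem_ofPred_eq, sum_contractVec, demand_merge]
  simp only [Finset.mem_univ, Finset.filter_true, if_true, sub_eq_iff_eq_add]
  refine and_congr_right fun _ => ⟨fun h => ⟨fun X hs ht => ?_, fun X hs ht => ?_⟩, ?_⟩
  · have := h X
    rw [filter_merge_mem_eq_self (iff_of_true hs ht), if_pos hs] at this
    linarith
  · have := h X
    rw [filter_merge_mem_eq_self (iff_of_false hs ht), if_neg hs] at this
    linarith
  · rintro ⟨h1, h2⟩ X
    by_cases hX : s e ∈ X
    · have := h1 (Finset.univ.filter fun x => merge (s e) (t e) x ∈ X)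
        (by simp [merge_left, hX]) (by simp [merge_right, hX])
      rw [if_pos hX]; linarith
    · have := h2 (Finset.univ.filter fun x => merge (s e) (t e) x ∈ X)
        (by simp [merge_left, hX]) (by simp [merge_right, hX])
      rw [if_neg hX]; linarith

lemma mem_indegLattice_insert_iff {A : Finset E} {e : E} (he : e ∉ A) (d : V → ℤ) :
    d ∈ indegLattice s t (insert e A) ↔ Unseparated s t A e d ∧
      Separated s t A (s e) (t e) 1 d ∧ Separated s t A (t e) (s e) 1 d := by
  simp only [indegLattice, Set.mem_ofPred_eq, Finset.card_insert_of_notMem he, Nat.cast_add,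
    Nat.cast_one, Unseparated, and_assoc]
  refine and_congr_right fun _ => ⟨fun h => ⟨?_, ?_, ?_, ?_⟩, ?_⟩
  · intro X hs ht
    rw [← demand_insert_of_mem s t he hs ht]; exact h X
  · intro X hs ht
    rw [← demand_insert_of_notMem s t he hs ht]; exact h X
  · intro X hs ht
    rw [← demand_insert_of_sep s t he (by tauto)]; exact h X
  · intro X hs ht
    rw [← demand_insert_of_sep s t he (by tauto)]; exact h X
  · rintro ⟨h1, h2, h3, h4⟩ X
    by_cases hs : s e ∈ X <;> by_cases ht : t e ∈ X
    · rw [demand_insert_of_mem s t he hs ht]; exact h1 X hs ht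
    · rw [demand_insert_of_sep s t he (by tauto)]; exact h3 X hs ht
    · rw [demand_insert_of_sep s t he (by tauto)]; exact h4 X ht hs
    · rw [demand_insert_of_notMem s t he hs ht]; exact h2 X hs ht

lemma mem_indegLattice_iff_add_single {A : Finset E} {e : E}
    (h : Quot.mk (linkRel s t ↑A) (s e) = Quot.mk _ (t e)) (d : V → ℤ) :
    d ∈ indegLattice s t A ↔ Unseparated s t A e (d + Pi.single (t e) 1) ∧
      Separated s t A (s e) (t e) 1 (d + Pi.single (t e) 1) ∧
      Separated s t A (t e) (s e) 2 (d + Pi.single (t e) 1) := by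
  simp only [indegLattice, Set.mem_ofPred_eq, Unseparated, and_assoc, Separated, sum_add_single,
    Finset.mem_univ, if_true, add_left_inj]
  refine and_congr_right fun _ => ⟨fun h' => ⟨?_, ?_, ?_, ?_⟩, ?_⟩
  · intro X hs ht
    have := h' X
    rw [if_pos ht]; linarith
  · intro X hs ht
    have := h' X
    rw [if_neg ht]; linarith
  · intro X hs ht
    have := h' X
    rw [demand_of_sep s t h (by tauto)] at this
    rw [if_neg ht]; linarith
  · intro X ht hs
    have := h' X
    rw [demand_of_sep s t h (by tauto)] at this
    rw [if_pos ht]; linarith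
  · rintro ⟨h1, h2, h3, h4⟩ X
    by_cases hs : s e ∈ X <;> by_cases ht : t e ∈ X
    · have := h1 X hs ht
      rw [if_pos ht] at this; linarith
    · have := h3 X hs ht
      rw [if_neg ht] at this
      rw [demand_of_sep s t h (by tauto)]; linarith
    · have := h4 X ht hs
      rw [if_pos ht] at this
      rw [demand_of_sep s t h (by tauto)]; linarith
    · have := h2 X hs ht
      rw [if_neg ht] at this; linarith

lemma indegLattice_merge_right {A : Finset E} {u v : V} (h : u ≠ v) {d : V → ℤ}
    (hd : d ∈ indegLattice (merge u v ∘ s) (merge u v ∘ t) A) : d v = 0 := by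
  refine le_antisymm ?_ (indegLattice_nonneg _ _ hd v)
  have h1 := hd.2 {v}ᶜ
  have h2 := hd.1
  rw [← Finset.sum_add_sum_compl {v}, Finset.sum_singleton] at h2
  have : edgesIn (merge u v ∘ s) (merge u v ∘ t) A {v}ᶜ = A := by
    simp [edgesIn, merge_ne h]
  rw [demand, this] at h1
  split_ifs at h1 <;> linarith

/-- The vectors in `indegLattice s t (insert e A)` which are tight on some set containing the
target of `e` but not its source. -/
def tightLattice (A : Finset E) (e : E) : Set (V → ℤ) :=
  {d | Unseparated s t A e d ∧ Separated s t A (s e) (t e) 1 d ∧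
    Separated s t A (t e) (s e) 1 d ∧ ¬ Separated s t A (t e) (s e) 2 d}

lemma tightLattice_le {A : Finset E} {e : E} {d d' : V → ℤ}
    (hd : d ∈ tightLattice s t A e) (hd' : d' ∈ tightLattice s t A e)
    (h : ∀ w, w ≠ s e → w ≠ t e → d w = d' w) : d (t e) ≤ d' (t e) := by
  obtain ⟨Z, hZt, hZs, hZ⟩ : ∃ Z : Finset V, t e ∈ Z ∧ s e ∉ Z ∧
      ∑ v ∈ Z, d v < ((edgesIn s t A Z).card : ℤ) + 2 := by
    have := hd.2.2.2
    unfold Separated at this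
    push Not at this
    exact this
  have h1 := hd'.2.2.1 Z hZt hZs
  rw [← Finset.add_sum_erase _ _ hZt] at hZ h1
  have : ∑ x ∈ Z.erase (t e), d x = ∑ x ∈ Z.erase (t e), d' x := by
    refine Finset.sum_congr rfl fun x hx => h x ?_ (Finset.ne_of_mem_erase hx)
    rintro rfl
    exact hZs (Finset.mem_of_mem_erase hx)
  linarith

lemma injOn_contractVec (A : Finset E) {e : E} (hne : s e ≠ t e) :
    Set.InjOn (contractVec (s e) (t e)) (tightLattice s t A e) := by
  intro d hd d' hd' hdd
  have h : ∀ w, w ≠ s e → w ≠ t e → d w = d' w := by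
    intro w hs ht
    rw [← contractVec_of_ne hs ht d, hdd, contractVec_of_ne hs ht]
  have ht : d (t e) = d' (t e) := le_antisymm (tightLattice_le s t hd hd' h)
    (tightLattice_le s t hd' hd fun w h1 h2 => (h w h1 h2).symm)
  have hs : d (s e) = d' (s e) := by
    have := congrFun hdd (s e)
    rw [contractVec_left hne, contractVec_left hne] at this
    linarith
  funext w
  by_cases h1 : w = s e
  · rw [h1, hs]
  · by_cases h2 : w = t e
    · rw [h2, ht]
    · exact h w h1 h2

lemma contractVec_image_tightLattice {A : Finset E} {e : E} (hne : s e ≠ t e)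
    (h : Quot.mk (linkRel s t ↑A) (s e) = Quot.mk _ (t e)) :
    contractVec (s e) (t e) '' tightLattice s t A e =
      indegLattice (merge (s e) (t e) ∘ s) (merge (s e) (t e) ∘ t) A := by
  ext c
  constructor
  · rintro ⟨d, hd, rfl⟩
    exact (contractVec_mem_iff s t A d).2 hd.1
  intro hc
  obtain ⟨Y, hY, hmax⟩ := Finset.exists_max_image
    (Finset.univ.filter fun Y : Finset V => t e ∈ Y ∧ s e ∉ Y)
    (fun Y => ((edgesIn s t A Y).card : ℤ) + 1 - ∑ x ∈ Y.erase (t e), c x)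
    ⟨{t e}, by simp [hne]⟩
  simp only [Finset.mem_filter, Finset.mem_univ, true_and] at hY hmax
  set m : ℤ := ((edgesIn s t A Y).card : ℤ) + 1 - ∑ x ∈ Y.erase (t e), c x with hm
  set d : V → ℤ := fun w => if w = t e then m else if w = s e then c (s e) + 1 - m else c w with hd
  have hcd : contractVec (s e) (t e) d = c := by
    funext w
    by_cases h1 : w = s e
    · rw [h1, contractVec_left hne]; simp [hd, hne]
    · by_cases h2 : w = t e
      · rw [h2, contractVec_right hne, indegLattice_merge_right s t hne hc]
      · rw [contractVec_of_ne h1 h2]; simp [hd, h1, h2]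
  have hsum : ∀ Z : Finset V, t e ∈ Z → s e ∉ Z →
      ∑ x ∈ Z, d x = m + ∑ x ∈ Z.erase (t e), c x := by
    intro Z ht hs
    rw [← Finset.add_sum_erase _ _ ht]
    congr 1
    · simp [hd]
    · refine Finset.sum_congr rfl fun x hx => ?_
      have h1 : x ≠ s e := by
        rintro rfl
        exact hs (Finset.mem_of_mem_erase hx)
      simp [hd, h1, Finset.ne_of_mem_erase hx]
  have hun : Unseparated s t A e d := by
    rw [← contractVec_mem_iff, hcd]; exact hc
  have hYd := hsum Y hY.1 hY.2
  refine ⟨d, ⟨hun, ?_, ?_, ?_⟩, hcd⟩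
  · intro X hs ht
    have h1 := Finset.sum_union_inter (s₁ := X) (s₂ := Y) (f := d)
    have h2 := hun.2.1 (X ∪ Y) (by simp [hs]) (by simp [hY.1])
    have h3 := hun.2.2 (X ∩ Y) (by simp [hY.2]) (by simp [ht])
    have h4 := card_edgesIn_add_le s t A X Y (hasBoundary_of_sep s t h (by tauto))
    linarith
  · intro Z ht hs
    have := hmax Z ⟨ht, hs⟩
    rw [hsum Z ht hs]
    linarith
  · intro hsep
    have := hsep Y hY.1 hY.2
    linarith

lemma ncard_indegLattice_insert {A : Finset E} {e : E} (he : e ∉ A) (hne : s e ≠ t e)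
    (h : Quot.mk (linkRel s t ↑A) (s e) = Quot.mk _ (t e)) :
    (indegLattice s t (insert e A)).ncard =
      (indegLattice (merge (s e) (t e) ∘ s) (merge (s e) (t e) ∘ t) A).ncard
        + (indegLattice s t A).ncard := by
  have hset : indegLattice s t (insert e A) = tightLattice s t A e ∪
      (fun d : V → ℤ => d + Pi.single (t e) 1) '' indegLattice s t A := by
    ext d
    have himg : d ∈ (fun d : V → ℤ => d + Pi.single (t e) 1) '' indegLattice s t A ↔
        Unseparated s t A e d ∧ Separated s t A (s e) (t e) 1 d ∧
          Separated s t A (t e) (s e) 2 d := by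
      constructor
      · rintro ⟨d, hd, rfl⟩
        exact (mem_indegLattice_iff_add_single s t h d).1 hd
      · intro hd
        refine ⟨d - Pi.single (t e) 1, (mem_indegLattice_iff_add_single s t h _).2 ?_, by simp⟩
        rwa [sub_add_cancel]
    have h21 : Separated s t A (t e) (s e) 2 d → Separated s t A (t e) (s e) 1 d :=
      fun h2 X ht hs => by linarith [h2 X ht hs]
    rw [Set.mem_union, himg, mem_indegLattice_insert_iff s t he]
    unfold tightLattice
    simp only [Set.mem_ofPred_eq]
    tauto
  have hdisj : Disjoint (tightLattice s t A e)
      ((fun d : V → ℤ => d + Pi.single (t e) 1) '' indegLattice s t A) := by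
    rw [Set.disjoint_right]
    rintro _ ⟨d, hd, rfl⟩ ht
    exact ht.2.2.2 ((mem_indegLattice_iff_add_single s t h d).1 hd).2.2
  have hfin := finite_indegLattice s t (insert e A)
  rw [hset] at hfin ⊢
  rw [Set.ncard_union_eq hdisj (hfin.subset Set.subset_union_left)
    (hfin.subset Set.subset_union_right), Set.InjOn.ncard_image (add_left_injective _).injOn,
    ← contractVec_image_tightLattice s t hne h, (injOn_contractVec s t A hne).ncard_image]

lemma ncard_indegLattice (A : Finset E) : ∀ s t : E → V, ((indegLattice s t A).ncard : ℤ) =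
    (-1) ^ (Fintype.card V + ncompSub s t ↑A) * forestSum s t A := by
  induction A using Finset.induction_on with
  | empty =>
    intro s t
    simp [indegLattice_empty, ncompSub_empty_s5, forestSum_empty, ← two_mul]
  | insert e A he ih =>
    intro s t
    rw [Finset.coe_insert]
    by_cases hne : s e = t e
    · rw [ncard_indegLattice_insert_of_loop s t he hne, ih, forestSum_insert_of_loop s t he hne,
        ncompSub_insert_of_eq s t _ _ (by rw [hne])]
    · by_cases h : Quot.mk (linkRel s t ↑A) (s e) = Quot.mk _ (t e)
      · rw [ncard_indegLattice_insert s t he hne h, Nat.cast_add, ih, ih,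
          forestSum_insert s t he hne, ncompSub_merge s t _ _ hne,
          ncompSub_insert_of_eq s t _ _ h]
        ring
      · rw [indegLattice_insert_of_bridge s t he h, forestSum_insert_of_bridge s t he h]
        simp

end Lattice

section Orientations

variable (s t : E → V)

lemma exists_minimal_walk {R : V → V → Prop} {x y : V} (h : Relation.ReflTransGen R x y) :
    ∃ (n : ℕ) (p : ℕ → V), p 0 = x ∧ p n = y ∧ (∀ i < n, R (p i) (p (i + 1))) ∧
      ∀ i j, i < j → j ≤ n → p i ≠ p j := by
  have hex : ∃ (n : ℕ) (p : ℕ → V), p 0 = x ∧ p n = y ∧ ∀ i < n, R (p i) (p (i + 1)) := by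
    induction h with
    | refl => exact ⟨0, fun _ => x, rfl, rfl, fun i hi => absurd hi (Nat.not_lt_zero _)⟩
    | @tail b c _ hbc ih =>
      obtain ⟨n, p, h0, hn, hp⟩ := ih
      refine ⟨n + 1, fun i => if i ≤ n then p i else c, by simpa using h0, by simp, ?_⟩
      intro i hi
      rcases Nat.lt_succ_iff_lt_or_eq.1 hi with hi | rfl
      · simpa [hi.le, Nat.succ_le_iff.2 hi] using hp i hi
      · simpa [hn] using hbc
  obtain ⟨p, h0, hn, hp⟩ := Nat.find_spec hex
  refine ⟨Nat.find hex, p, h0, hn, hp, fun i j hij hj heq => ?_⟩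
  refine Nat.find_min hex (m := Nat.find hex - (j - i)) (by omega)
    ⟨fun k => if k ≤ i then p k else p (k + (j - i)), by simpa using h0, ?_, ?_⟩
  · by_cases hle : Nat.find hex - (j - i) ≤ i
    · have hj' : j = Nat.find hex := by omega
      have hi' : Nat.find hex - (j - i) = i := by omega
      simp only [hi', le_refl, if_true]
      rw [heq, ← hn, ← hj']
    · simp only [if_neg hle]
      rw [Nat.sub_add_cancel (by omega), hn]
  · intro k hk
    rcases lt_trichotomy k i with hki | rfl | hki
    · simpa [hki.le, Nat.succ_le_iff.2 hki] using hp k (by omega)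
    · have := hp j (by omega)
      simp only [le_refl, if_true, if_neg (Nat.not_succ_le_self k)]
      rw [heq, show k + 1 + (j - k) = j + 1 by omega]
      exact this
    · have := hp (k + (j - i)) (by omega)
      simp only [if_neg (not_le.2 hki), if_neg (show ¬ k + 1 ≤ i by omega)]
      rwa [show k + 1 + (j - i) = k + (j - i) + 1 by omega]

lemma exists_dirCycle_of_reflTransGen (e : E)
    (h : Relation.ReflTransGen (fun x y => ∃ f, s f = x ∧ t f = y) (t e) (s e)) :
    ∃ (n : ℕ) (c : Fin (n + 1) → E), IsDirCycle s t n c ∧ e ∈ Set.range c := by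
  obtain ⟨n, p, h0, hn, hp, hinj⟩ := exists_minimal_walk h
  have hex : ∀ k : Fin (n + 1), ∃ f, s f = p k ∧ t f = p ((k + 1 : Fin (n + 1)) : ℕ) ∧
      (k = Fin.last n → f = e) := by
    intro k
    by_cases hk : k = Fin.last n
    · subst hk
      exact ⟨e, by simp [hn], by simp [h0], fun _ => rfl⟩
    · have hkn : (k : ℕ) < n := by
        have := k.2
        have : (k : ℕ) ≠ n := fun h' => hk (Fin.ext h')
        omega
      obtain ⟨f, hf1, hf2⟩ := hp k hkn
      exact ⟨f, hf1, by rw [Fin.val_add_one, if_neg hk, hf2], fun h' => absurd h' hk⟩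
  choose c hc1 hc2 hc3 using hex
  refine ⟨n, c, ⟨fun i j hij => ?_, fun i => ?_⟩, ⟨Fin.last n, hc3 _ rfl⟩⟩
  · simp only [hc1] at hij
    rcases lt_trichotomy (i : ℕ) j with hlt | heq | hlt
    · exact absurd hij (hinj _ _ hlt (Nat.lt_succ_iff.1 j.2))
    · exact Fin.ext heq
    · exact absurd hij.symm (hinj _ _ hlt (Nat.lt_succ_iff.1 i.2))
  · rw [hc2, hc1]

lemma edgesIn_reorient (σ : Set E) (A : Finset E) (X : Finset V) :
    edgesIn (rsrc s t σ) (rtgt s t σ) A X = edgesIn s t A X := by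
  refine Finset.filter_congr fun e _ => ?_
  unfold rsrc rtgt
  split_ifs <;> tauto

lemma hasBoundary_reorient (σ : Set E) (A : Finset E) (X : Finset V) :
    HasBoundary (rsrc s t σ) (rtgt s t σ) A X ↔ HasBoundary s t A X := by
  refine exists_congr fun e => and_congr_right fun _ => ?_
  unfold rsrc rtgt
  split_ifs <;> tauto

variable [Fintype E]

lemma sum_indegSeq (σ : Set E) (X : Finset V) : ∑ v ∈ X, indegSeq s t σ v =
    ((Finset.univ.filter fun e => rtgt s t σ e ∈ X).card : ℤ) := by
  rw [Finset.card_eq_sum_card_fiberwise (f := rtgt s t σ) (t := X) (by intro e; simp)]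
  push_cast
  refine Finset.sum_congr rfl fun v hv => ?_
  rw [indegSeq, Nat.card_eq_fintype_card, Fintype.card_subtype, Finset.filter_filter]
  congr 2
  ext e
  simp only [Finset.mem_filter, Finset.mem_univ, true_and]
  exact ⟨fun h => ⟨h ▸ hv, h⟩, fun h => h.2⟩

variable [Fintype V]

/-- An oriented graph is totally cyclic if and only if it has no directed cut. -/
lemma totallyCyclic_iff_forall_hasBoundary : TotallyCyclic s t ↔
    ∀ X : Finset V, HasBoundary s t Finset.univ X → ∃ e, s e ∉ X ∧ t e ∈ X := by
  constructor
  · rintro h X ⟨f, -, hf⟩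
    by_contra! hno
    obtain ⟨n, c, ⟨-, hc⟩, i, rfl⟩ := h f
    have hsi : s (c i) ∈ X := by
      by_contra hs
      have := hno _ hs
      tauto
    have hti : t (c i) ∉ X := by tauto
    set B : Finset (Fin (n + 1)) := Finset.univ.filter fun j => s (c j) ∉ X with hB
    have hmap : B.map (Equiv.addRight 1).toEmbedding = B := by
      refine Finset.eq_of_subset_of_card_le ?_ (by simp)
      intro j hj
      obtain ⟨k, hk, rfl⟩ := Finset.mem_map.1 hj
      simp only [hB, Finset.mem_filter, Finset.mem_univ, true_and] at hk ⊢
      have := hno _ hk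
      rwa [hc k] at this
    have hi : i + 1 ∈ B := by
      simp only [hB, Finset.mem_filter, Finset.mem_univ, true_and]
      rwa [← hc i]
    rw [← hmap] at hi
    obtain ⟨k, hk, hki⟩ := Finset.mem_map.1 hi
    have : k = i := by simpa using hki
    subst this
    simp only [hB, Finset.mem_filter, Finset.mem_univ, true_and] at hk
    exact hk hsi
  · intro h e
    refine exists_dirCycle_of_reflTransGen s t e ?_
    by_contra hne
    obtain ⟨f, hfs, hft⟩ := h (Finset.univ.filter fun w =>
      ¬ Relation.ReflTransGen (fun x y => ∃ f, s f = x ∧ t f = y) (t e) w)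
      ⟨e, Finset.mem_univ e, by simp [hne, Relation.ReflTransGen.refl]⟩
    simp only [Finset.mem_filter, Finset.mem_univ, true_and, not_not] at hfs hft
    exact hft (hfs.tail ⟨f, rfl, rfl⟩)

/-- A reorientation is totally cyclic if and only if its in-degree sequence lies in the lattice. -/
lemma indegSeq_mem_indegLattice_iff (σ : Set E) :
    indegSeq s t σ ∈ indegLattice s t Finset.univ ↔
      TotallyCyclic (rsrc s t σ) (rtgt s t σ) := by
  have hsub : ∀ X : Finset V, edgesIn s t Finset.univ X ⊆
      Finset.univ.filter fun e => rtgt s t σ e ∈ X := by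
    intro X e he
    rw [← edgesIn_reorient s t σ] at he
    simp only [edgesIn, Finset.mem_filter] at he ⊢
    tauto
  rw [totallyCyclic_iff_forall_hasBoundary]
  constructor
  · rintro ⟨-, h⟩ X hX
    rw [hasBoundary_reorient] at hX
    have := h X
    rw [sum_indegSeq, demand, if_pos hX] at this
    obtain ⟨e, he, he'⟩ := Finset.exists_mem_notMem_of_card_lt_card (by omega :
      (edgesIn s t Finset.univ X).card < (Finset.univ.filter fun e => rtgt s t σ e ∈ X).card)
    rw [← edgesIn_reorient s t σ] at he'
    simp only [edgesIn, Finset.mem_filter, Finset.mem_univ, true_and] at he he'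
    exact ⟨e, by tauto, he⟩
  · intro h
    refine ⟨by rw [sum_indegSeq]; simp, fun X => ?_⟩
    rw [sum_indegSeq, demand]
    split_ifs with hX
    · obtain ⟨e, he, he'⟩ := h X ((hasBoundary_reorient s t σ _ _).2 hX)
      have hnot : e ∉ edgesIn s t Finset.univ X := by
        rw [← edgesIn_reorient s t σ]
        simp [edgesIn, he]
      have := Finset.card_le_card (Finset.insert_subset
        (show e ∈ Finset.univ.filter fun e => rtgt s t σ e ∈ X by simpa using he') (hsub X))
      rw [Finset.card_insert_of_notMem hnot] at this
      exact_mod_cast this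
    · have := Finset.card_le_card (hsub X)
      simpa using this

/-- Hakimi's theorem for the vectors in the lattice, via Hall's marriage theorem. -/
lemma exists_indegSeq_eq {d : V → ℤ} (hd : d ∈ indegLattice s t Finset.univ) :
    ∃ σ : Set E, indegSeq s t σ = d := by
  have hnn := indegLattice_nonneg s t hd
  obtain ⟨g, hginj, hg⟩ := (Finset.all_card_le_biUnion_card_iff_exists_injective
    (fun e : E => ({s e, t e} : Finset V).sigma fun v => Finset.range (d v).toNat)).1 (by
      intro F
      set X : Finset V := F.biUnion fun e => {s e, t e} with hX
      have hbi : (F.biUnion fun e => ({s e, t e} : Finset V).sigma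
          fun v => Finset.range (d v).toNat) = X.sigma fun v => Finset.range (d v).toNat := by
        ext ⟨v, i⟩
        simp only [hX, Finset.mem_biUnion, Finset.mem_sigma]
        tauto
      have hF : F ⊆ edgesIn s t Finset.univ X := by
        intro e he
        simp only [edgesIn, hX, Finset.mem_filter, Finset.mem_univ, true_and, Finset.mem_biUnion]
        exact ⟨⟨e, he, by simp⟩, ⟨e, he, by simp⟩⟩
      rw [hbi, Finset.card_sigma]
      simp only [Finset.card_range]
      have h1 := hd.2 X
      have h2 : ((∑ v ∈ X, (d v).toNat : ℕ) : ℤ) = ∑ v ∈ X, d v := by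
        push_cast
        exact Finset.sum_congr rfl fun v _ => by simp [hnn v]
      have h3 := Finset.card_le_card hF
      unfold demand at h1
      split_ifs at h1 <;> omega)
  refine ⟨{e | (g e).1 = s e}, ?_⟩
  set σ : Set E := {e | (g e).1 = s e} with hσ
  have hhead : ∀ e, rtgt s t σ e = (g e).1 := by
    intro e
    have := hg e
    simp only [Finset.mem_sigma, Finset.mem_insert, Finset.mem_singleton] at this
    by_cases he : (g e).1 = s e
    · rw [rtgt, if_pos (show e ∈ σ from he), he]
    · rw [rtgt, if_neg (show e ∉ σ from he)]
      tauto
  have hle : ∀ v ∈ Finset.univ, indegSeq s t σ v ≤ d v := by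
    intro v _
    have h1 := sum_indegSeq s t σ {v}
    rw [Finset.sum_singleton] at h1
    have h2 : (Finset.univ.filter fun e => rtgt s t σ e ∈ ({v} : Finset V)).card ≤
        (Finset.range (d v).toNat).card := by
      refine Finset.card_le_card_of_injOn (fun e => (g e).2) ?_ ?_
      · intro e he
        simp only [Finset.coe_filter, Set.mem_ofPred_eq, Finset.mem_univ, true_and, hhead,
          Finset.mem_singleton] at he
        have := (Finset.mem_sigma.1 (hg e)).2
        rwa [he] at this
      · intro e he f hf hef
        simp only [Finset.coe_filter, Set.mem_ofPred_eq, Finset.mem_univ, true_and, hhead,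
          Finset.mem_singleton] at he hf
        exact hginj (Sigma.ext (he.trans hf.symm) (heq_of_eq hef))
    rw [Finset.card_range] at h2
    have := hnn v
    omega
  have hsum : ∑ v, indegSeq s t σ v = ∑ v, d v := by
    rw [sum_indegSeq, hd.1]; simp
  funext v
  exact (Finset.sum_eq_sum_iff_of_le hle).1 hsum v (Finset.mem_univ v)

lemma setOf_indegSeq_eq : {d : V → ℤ | ∃ σ : Set E,
    TotallyCyclic (rsrc s t σ) (rtgt s t σ) ∧ d = indegSeq s t σ} =
      indegLattice s t Finset.univ := by
  ext d
  constructor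
  · rintro ⟨σ, hσ, rfl⟩
    exact (indegSeq_mem_indegLattice_iff s t σ).2 hσ
  · intro hd
    obtain ⟨σ, rfl⟩ := exists_indegSeq_eq s t hd
    exact ⟨σ, (indegSeq_mem_indegLattice_iff s t σ).1 hd, rfl⟩

end Orientations

/-- `t_G(0,1) = (-1)^{ξ(G)} φ̄_G(0)` is the number of in-degree sequences of
totally cyclic reorientations of `G`. -/
theorem tutte_zero_one_eval {V E : Type} [Fintype V] [Fintype E]
    (src tgt : E → V) (P : Polynomial ℚ)
    (hP : ∀ m : ℕ, 0 < m → P.eval (m : ℚ) = nzFlowCount src tgt m) :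
    tutte src tgt 0 1 = (-1 : ℚ) ^ (xi src tgt) * P.eval 0 ∧
    tutte src tgt 0 1 =
      Nat.card {d : V → ℤ // ∃ σ : Set E,
        TotallyCyclic (rsrc src tgt σ) (rtgt src tgt σ) ∧ d = indegSeq src tgt σ} := by
  have hT := tutte_zero_one_eq_forestSum src tgt
  refine ⟨?_, ?_⟩
  · rw [hT, eval_zero_flowPolynomial src tgt P hP, ← mul_assoc]
    congr 1
    rw [xi, zpow_add₀ (by norm_num), zpow_sub₀ (by norm_num), zpow_natCast, zpow_natCast,
      zpow_natCast, pow_add]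
    have h1 : ((-1 : ℚ) ^ Fintype.card E) * (-1) ^ Fintype.card E = 1 := by
      rw [← mul_pow]; norm_num
    have h2 : ((-1 : ℚ) ^ Fintype.card V) * (-1) ^ Fintype.card V = 1 := by
      rw [← mul_pow]; norm_num
    rw [div_eq_mul_inv, inv_eq_of_mul_eq_one_right h2]
    linear_combination (-(-1 : ℚ) ^ Fintype.card V * (-1) ^ ncomp src tgt) * h1
  · have hN := ncard_indegLattice Finset.univ src tgt
    rw [Finset.coe_univ, ← setOf_indegSeq_eq] at hN
    rw [hT, ncomp]
    exact_mod_cast hN.symm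

end ModularFlows
end
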